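/- arXiv:math/0512386 — 3 statements merged into one kernel-verified Lean document; each statement's English description precedes it below -/
import Mathlib

section
/- Let A be a nonempty finite set, let Q be a strictly positive stochastic matrix on A with stationary probability vector mu, and let P be the stationary Markov measure on A^N determined by (Q, mu). Then for P-almost every omega, lim_{n->infinity} (1/n) log R_n(omega) = - sum_{x,y in A} mu(x) Q(x,y) log Q(x,y), where R_n(omega) = inf{ k >= 1 : omega_{k+i} = omega_i for all 0 <= i <= n-1 } is the first return time of the initial n-block. -/
open MeasureTheory Filter Finset Real

/-- First return time of the initial `n`-block:
`R_n(ω) = inf { k ≥ 1 : ω_{k+i} = ω_i for all 0 ≤ i ≤ n-1 }`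
(with the convention `sInf ∅ = 0` in `ℕ`; the set is a.s. nonempty). -/
noncomputable def returnTime {A : Type*} (n : ℕ) (ω : ℕ → A) : ℕ :=
  sInf {k | 1 ≤ k ∧ ∀ i < n, ω (k + i) = ω i}

section helpers
variable {A : Type*}

/-- Product of transition weights along the path. -/
noncomputable def pathProd (K : A → A → ℝ) (n : ℕ) (ω : ℕ → A) : ℝ :=
  ∏ i ∈ Finset.range n, K (ω i) (ω (i + 1))

/-- Periodic extension of a block. -/
def perExt (n : ℕ) (a : Fin (n + 1) → A) : ℕ → A := fun i => a (Fin.ofNat (n + 1) i)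

lemma perExt_of_le (n : ℕ) (ω : ℕ → A) (i : ℕ) (hi : i ≤ n) :
    perExt n (fun j : Fin (n + 1) => ω j) i = ω i := by
  simp [perExt, Nat.mod_eq_of_lt (Nat.lt_succ_of_le hi)]

lemma perExt_add (n : ℕ) (a : Fin (n + 1) → A) (i : ℕ) :
    perExt n a (n + 1 + i) = perExt n a i := by
  unfold perExt
  congr 1
  ext
  simp

lemma pathProd_congr (K : A → A → ℝ) (n : ℕ) (ω ω' : ℕ → A) (h : ∀ i ≤ n, ω i = ω' i) :
    pathProd K n ω = pathProd K n ω' := by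
  unfold pathProd
  refine Finset.prod_congr rfl fun i hi => ?_
  have := Finset.mem_range.1 hi
  rw [h i (by omega), h (i + 1) (by omega)]

lemma pathProd_nonneg (K : A → A → ℝ) (hK : ∀ x y, 0 ≤ K x y) (n : ℕ) (ω : ℕ → A) :
    0 ≤ pathProd K n ω := Finset.prod_nonneg fun _ _ => hK _ _

lemma perExt_snoc (n : ℕ) (b : Fin (n + 1) → A) (y : A) (i : ℕ) (hi : i ≤ n) :
    perExt (n + 1) (Fin.snoc b y : Fin (n + 1 + 1) → A) i = perExt n b i := by
  unfold perExt
  have h1 : Fin.ofNat (n + 1 + 1) i = Fin.castSucc (⟨i, by omega⟩ : Fin (n + 1)) := by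
    ext; simp; omega
  have h2 : Fin.ofNat (n + 1) i = (⟨i, by omega⟩ : Fin (n + 1)) := by
    ext; simp; omega
  rw [h1, h2, Fin.snoc_castSucc]

lemma perExt_snoc_last (n : ℕ) (b : Fin (n + 1) → A) (y : A) :
    perExt (n + 1) (Fin.snoc b y : Fin (n + 1 + 1) → A) (n + 1) = y := by
  unfold perExt
  have h1 : Fin.ofNat (n + 1 + 1) (n + 1) = Fin.last (n + 1) := by
    ext; simp
  rw [h1, Fin.snoc_last]

lemma sum_pathProd_le [Fintype A] (K : A → A → ℝ) (hK : ∀ x y, 0 ≤ K x y) (ρ : ℝ)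
    (hρ : ∀ x, ∑ y, K x y ≤ ρ) (v : A → ℝ) (hv : ∀ x, 0 ≤ v x) (hρ0 : 0 ≤ ρ) (n : ℕ) :
    ∑ a : Fin (n + 1) → A, v (perExt n a 0) * pathProd K n (perExt n a)
      ≤ (∑ x, v x) * ρ ^ n := by
  induction n with
  | zero =>
    simp only [pathProd, Finset.range_zero, Finset.prod_empty, mul_one, pow_zero]
    refine le_of_eq ?_
    refine Fintype.sum_equiv (Equiv.funUnique (Fin 1) A) _ _ fun a => ?_
    simp [perExt]
  | succ n ih =>
    have e : ∑ a : Fin (n + 1 + 1) → A, v (perExt (n + 1) a 0) * pathProd K (n + 1) (perExt (n + 1) a)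
        = ∑ b : Fin (n + 1) → A, ∑ y : A,
          v (perExt n b 0) * pathProd K n (perExt n b) * K (perExt n b n) y := by
      rw [← Fintype.sum_prod_type_right']
      symm
      refine Fintype.sum_equiv (Fin.snocEquiv (fun _ => A)) _ _ fun p => ?_
      obtain ⟨y, b⟩ := p
      simp only [Fin.snocEquiv, Equiv.coe_fn_mk]
      rw [perExt_snoc n b y 0 (by omega)]
      have : pathProd K (n + 1) (perExt (n + 1) (Fin.snoc b y : Fin (n + 1 + 1) → A))
          = pathProd K n (perExt n b) * K (perExt n b n) y := by
        rw [pathProd, Finset.prod_range_succ, perExt_snoc n b y n le_rfl, perExt_snoc_last]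
        congr 1
        exact pathProd_congr K n _ _ (fun i hi => perExt_snoc n b y i hi)
      rw [this]; ring
    rw [e]
    calc _ ≤ ∑ b : Fin (n + 1) → A, v (perExt n b 0) * pathProd K n (perExt n b) * ρ := by
          refine Finset.sum_le_sum fun b _ => ?_
          rw [← Finset.mul_sum]
          exact mul_le_mul_of_nonneg_left (hρ _)
            (mul_nonneg (hv _) (pathProd_nonneg K hK _ _))
      _ ≤ _ := by
          rw [← Finset.sum_mul, pow_succ, ← mul_assoc]
          exact mul_le_mul_of_nonneg_right ih hρ0

lemma ae_of_real_le {Ω : Type*} [MeasurableSpace Ω] (P : Measure Ω) [IsProbabilityMeasure P]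
    (s : ℕ → Set Ω) (C r : ℝ) (hr0 : 0 ≤ r) (hr : r < 1) (h : ∀ n, P.real (s n) ≤ C * r ^ n) :
    ∀ᵐ ω ∂P, ∀ᶠ n in atTop, ω ∉ s n := by
  apply ae_eventually_notMem
  have hs : Summable (fun n => P.real (s n)) :=
    Summable.of_nonneg_of_le (fun _ => measureReal_nonneg) h
      ((summable_geometric_of_lt_one hr0 hr).mul_left C)
  have : ∀ n, P (s n) = ENNReal.ofReal (P.real (s n)) := fun n => by simp
  simp_rw [this]
  rw [← ENNReal.ofReal_tsum_of_nonneg (fun _ => measureReal_nonneg) hs]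
  exact ENNReal.ofReal_ne_top

lemma cover_le [Fintype A] [MeasurableSpace A] (Q : A → A → ℝ) (μ : A → ℝ)
    (P : Measure (ℕ → A)) [IsProbabilityMeasure P]
    (hP : ∀ (n : ℕ) (a : ℕ → A),
      (P {ω | ∀ i ≤ n, ω i = a i}).toReal
        = μ (a 0) * ∏ i ∈ Finset.range n, Q (a i) (a (i + 1)))
    (s : Set (ℕ → A)) (n N : ℕ) (F : Finset (Fin (n + 1) → A))
    (h : ∀ ω ∈ s, ∃ a ∈ F, ∀ i ≤ N, ω i = perExt n a i) :
    P.real s ≤ ∑ a ∈ F, μ (perExt n a 0) * pathProd Q N (perExt n a) := by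
  have hsub : s ⊆ ⋃ a ∈ F, {ω | ∀ i ≤ N, ω i = perExt n a i} := by
    intro ω hω
    obtain ⟨a, ha, h'⟩ := h ω hω
    simp only [Set.mem_iUnion]
    exact ⟨a, ha, h'⟩
  refine (measureReal_mono hsub (measure_ne_top _ _)).trans ((measureReal_biUnion_finset_le F _).trans ?_)
  exact Finset.sum_le_sum fun a _ => (hP N (perExt n a)).le

/-- A match at lag `m+1` with small path weight is unlikely. -/
lemma match_le [Fintype A] [MeasurableSpace A] (Q : A → A → ℝ) (μ : A → ℝ)
    (hQpos : ∀ x y, 0 < Q x y)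
    (hQrow : ∀ x, ∑ y, Q x y = 1)
    (hμnonneg : ∀ x, 0 ≤ μ x) (hμsum : ∑ x, μ x = 1)
    (P : Measure (ℕ → A)) [IsProbabilityMeasure P]
    (hP : ∀ (n : ℕ) (a : ℕ → A),
      (P {ω | ∀ i ≤ n, ω i = a i}).toReal
        = μ (a 0) * ∏ i ∈ Finset.range n, Q (a i) (a (i + 1)))
    (m l : ℕ) (p : ℝ) (hp : 0 ≤ p) :
    P.real {ω | (∀ i < l + 1, ω (m + 1 + i) = ω i) ∧ pathProd Q l ω ≤ p} ≤ p := by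
  classical
  have hQ1 : ∀ x y, Q x y ≤ 1 := fun x y => by
    rw [← hQrow x]
    exact Finset.single_le_sum (f := fun y => Q x y) (fun z _ => (hQpos x z).le) (Finset.mem_univ y)
  have hQ0 : ∀ x y, 0 ≤ Q x y := fun x y => (hQpos x y).le
  refine (cover_le Q μ P hP _ m (m + 1 + l)
    (Finset.univ.filter fun a => pathProd Q l (perExt m a) ≤ p) ?_).trans ?_
  · rintro ω ⟨h1, h2⟩
    have key : ∀ i ≤ m + 1 + l, ω i = perExt m (fun j : Fin (m + 1) => ω j) i := by
      intro i
      induction i using Nat.strong_induction_on with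
      | _ i ih =>
        intro hi
        by_cases him : i ≤ m
        · rw [perExt_of_le m ω i him]
        · obtain ⟨j, rfl⟩ : ∃ j, i = m + 1 + j := ⟨i - (m + 1), by omega⟩
          rw [perExt_add, h1 j (by omega)]
          exact ih j (by omega) (by omega)
    refine ⟨fun j => ω j, ?_, key⟩
    simp only [Finset.mem_filter, Finset.mem_univ, true_and]
    rw [← pathProd_congr Q l ω _ (fun i hi => key i (by omega))]
    exact h2
  · calc _ ≤ ∑ a ∈ Finset.univ.filter (fun a => pathProd Q l (perExt m a) ≤ p),
          μ (perExt m a 0) * pathProd Q m (perExt m a) * p := by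
          refine Finset.sum_le_sum fun a ha => ?_
          have hap := (Finset.mem_filter.1 ha).2
          rw [mul_assoc]
          refine mul_le_mul_of_nonneg_left ?_ (hμnonneg _)
          have : pathProd Q (m + 1 + l) (perExt m a) =
              pathProd Q m (perExt m a) * (Q (perExt m a m) (perExt m a (m + 1))
                * pathProd Q l (perExt m a)) := by
            rw [pathProd, Finset.prod_range_add, Finset.prod_range_succ, ← mul_assoc]
            congr 1
            refine Finset.prod_congr rfl fun i _ => ?_
            rw [perExt_add, add_assoc, perExt_add]
          rw [this]
          refine mul_le_mul_of_nonneg_left ?_ (pathProd_nonneg Q hQ0 _ _)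
          exact (mul_le_of_le_one_left (pathProd_nonneg Q hQ0 _ _) (hQ1 _ _)).trans hap
      _ ≤ ∑ a, μ (perExt m a 0) * pathProd Q m (perExt m a) * p := by
          refine Finset.sum_le_sum_of_subset_of_nonneg (Finset.subset_univ _) fun a _ _ => ?_
          exact mul_nonneg (mul_nonneg (hμnonneg _) (pathProd_nonneg Q hQ0 _ _)) hp
      _ ≤ p := by
          rw [← Finset.sum_mul]
          refine mul_le_of_le_one_left hp ?_
          have := sum_pathProd_le Q hQ0 1 (fun x => (hQrow x).le) μ hμnonneg zero_le_one m
          simpa [hμsum] using this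

/-- Law of large numbers (upper half) for martingale differences. -/
lemma lln_upper [Fintype A] [Nonempty A] [MeasurableSpace A] (Q : A → A → ℝ) (μ : A → ℝ)
    (hQpos : ∀ x y, 0 < Q x y)
    (hQrow : ∀ x, ∑ y, Q x y = 1)
    (hμnonneg : ∀ x, 0 ≤ μ x) (hμsum : ∑ x, μ x = 1)
    (P : Measure (ℕ → A)) [IsProbabilityMeasure P]
    (hP : ∀ (n : ℕ) (a : ℕ → A),
      (P {ω | ∀ i ≤ n, ω i = a i}).toReal
        = μ (a 0) * ∏ i ∈ Finset.range n, Q (a i) (a (i + 1)))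
    (D : A → A → ℝ) (hD : ∀ x, ∑ y, Q x y * D x y = 0) (ε : ℝ) (hε : 0 < ε) :
    ∀ᵐ ω ∂P, ∀ᶠ n : ℕ in atTop,
      ∑ i ∈ Finset.range n, D (ω i) (ω (i + 1)) < ε * n := by
  classical
  have hQ0 : ∀ x y, 0 ≤ Q x y := fun x y => (hQpos x y).le
  obtain ⟨C, hC1, hC⟩ : ∃ C : ℝ, 1 ≤ C ∧ ∀ x y, |D x y| ≤ C := by
    refine ⟨1 + ∑ x, ∑ y, |D x y|, ?_, fun x y => ?_⟩
    · have : 0 ≤ ∑ x, ∑ y, |D x y| :=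
        Finset.sum_nonneg fun _ _ => Finset.sum_nonneg fun _ _ => abs_nonneg _
      linarith
    · have h1 : |D x y| ≤ ∑ y, |D x y| :=
        Finset.single_le_sum (f := fun y => |D x y|) (fun _ _ => abs_nonneg _) (Finset.mem_univ y)
      have h2 : ∑ y, |D x y| ≤ ∑ x, ∑ y, |D x y| :=
        Finset.single_le_sum (f := fun x => ∑ y, |D x y|)
          (fun _ _ => Finset.sum_nonneg fun _ _ => abs_nonneg _) (Finset.mem_univ x)
      linarith
  have hCpos : 0 < C := by linarith
  set t : ℝ := min (1 / C) (ε / (2 * C ^ 2)) with ht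
  have ht0 : 0 < t := by positivity
  have htC : t * C ≤ 1 := by
    have : t ≤ 1 / C := min_le_left _ _
    rwa [le_div_iff₀ hCpos] at this
  have htε : t * C ^ 2 < ε := by
    have h : t ≤ ε / (2 * C ^ 2) := min_le_right _ _
    rw [le_div_iff₀ (by positivity)] at h
    nlinarith
  set ρ : ℝ := 1 + (t * C) ^ 2 with hρdef
  have hρ0 : 0 ≤ ρ := by positivity
  have hρlt : ρ < Real.exp (t * ε) := by
    have : t * ε + 1 ≤ Real.exp (t * ε) := Real.add_one_le_exp _
    nlinarith
  set K : A → A → ℝ := fun x y => Q x y * Real.exp (t * D x y) with hKdef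
  have hK0 : ∀ x y, 0 ≤ K x y := fun x y => mul_nonneg (hQ0 x y) (Real.exp_pos _).le
  have hKρ : ∀ x, ∑ y, K x y ≤ ρ := by
    intro x
    calc ∑ y, K x y ≤ ∑ y, (Q x y + t * (Q x y * D x y) + Q x y * (t * C) ^ 2) := by
          refine Finset.sum_le_sum fun y _ => ?_
          have hb : |t * D x y| ≤ t * C := by
            rw [abs_mul, abs_of_pos ht0]
            exact mul_le_mul_of_nonneg_left (hC x y) ht0.le
          have h1 := (abs_le.1 (Real.abs_exp_sub_one_sub_id_le (hb.trans htC))).2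
          have h2 : (t * D x y) ^ 2 ≤ (t * C) ^ 2 := by
            rw [← sq_abs (t * D x y)]
            exact pow_le_pow_left₀ (abs_nonneg _) hb 2
          have h3 : Real.exp (t * D x y) ≤ 1 + t * D x y + (t * C) ^ 2 := by linarith
          have := mul_le_mul_of_nonneg_left h3 (hQ0 x y)
          simp only [hKdef]
          linarith
      _ = ρ := by
          rw [Finset.sum_add_distrib, Finset.sum_add_distrib, ← Finset.mul_sum, ← Finset.sum_mul,
            hD, hQrow]
          ring
  have := ae_of_real_le P (fun n => {ω | ε * n ≤ ∑ i ∈ Finset.range n, D (ω i) (ω (i + 1))})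
    1 (ρ * Real.exp (-(t * ε))) (by positivity)
    (by
      rw [Real.exp_neg, ← div_eq_mul_inv, div_lt_one (Real.exp_pos _)]
      exact hρlt)
    (by
      intro n
      refine (cover_le Q μ P hP _ n n
        (Finset.univ.filter fun a => ε * n ≤ ∑ i ∈ Finset.range n,
          D (perExt n a i) (perExt n a (i + 1))) ?_).trans ?_
      · intro ω hω
        refine ⟨fun j => ω j, ?_, fun i hi => (perExt_of_le n ω i hi).symm⟩
        simp only [Finset.mem_filter, Finset.mem_univ, true_and]
        have hω' : ε * n ≤ ∑ i ∈ Finset.range n, D (ω i) (ω (i + 1)) := hω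
        refine hω'.trans (le_of_eq ?_)
        refine Finset.sum_congr rfl fun i hi => ?_
        have := Finset.mem_range.1 hi
        rw [perExt_of_le n ω i (by omega), perExt_of_le n ω (i + 1) (by omega)]
      · calc _ ≤ ∑ a ∈ (Finset.univ.filter fun a => ε * n ≤ ∑ i ∈ Finset.range n,
                D (perExt n a i) (perExt n a (i + 1))),
                μ (perExt n a 0) * pathProd K n (perExt n a) * Real.exp (-(t * ε)) ^ n := by
              refine Finset.sum_le_sum fun a ha => ?_
              have hap := (Finset.mem_filter.1 ha).2
              rw [mul_assoc]
              refine mul_le_mul_of_nonneg_left ?_ (hμnonneg _)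
              have : pathProd K n (perExt n a) = pathProd Q n (perExt n a) *
                  Real.exp (t * ∑ i ∈ Finset.range n, D (perExt n a i) (perExt n a (i + 1))) := by
                rw [Finset.mul_sum, Real.exp_sum, pathProd, pathProd, ← Finset.prod_mul_distrib]
              rw [this, ← Real.exp_nat_mul, mul_assoc, ← Real.exp_add]
              refine le_mul_of_one_le_right (pathProd_nonneg Q hQ0 _ _) ?_
              apply Real.one_le_exp
              nlinarith
          _ ≤ ∑ a, μ (perExt n a 0) * pathProd K n (perExt n a) * Real.exp (-(t * ε)) ^ n := by
              refine Finset.sum_le_sum_of_subset_of_nonneg (Finset.subset_univ _) fun a _ _ => ?_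
              exact mul_nonneg (mul_nonneg (hμnonneg _) (pathProd_nonneg K hK0 _ _))
                (by positivity)
          _ ≤ _ := by
              rw [← Finset.sum_mul, one_mul, mul_pow]
              refine mul_le_mul_of_nonneg_right ?_ (by positivity)
              have := sum_pathProd_le K hK0 ρ hKρ μ hμnonneg hρ0 n
              simpa [hμsum] using this)
  filter_upwards [this] with ω hω
  filter_upwards [hω] with n hn
  simpa using hn

/-- Poisson equation. -/
lemma poisson [Fintype A] [Nonempty A] (Q : A → A → ℝ) (μ : A → ℝ)
    (hQpos : ∀ x y, 0 < Q x y)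
    (hQrow : ∀ x, ∑ y, Q x y = 1) (hμsum : ∑ x, μ x = 1)
    (hμstat : ∀ y, ∑ x, μ x * Q x y = μ y) (F : A → ℝ) (hF : ∑ x, μ x * F x = 0) :
    ∃ g : A → ℝ, ∀ x, g x - ∑ y, Q x y * g y = F x := by
  have hstat : ∀ g : A → ℝ, ∑ x, μ x * ∑ y, Q x y * g y = ∑ y, μ y * g y := by
    intro g
    simp_rw [Finset.mul_sum]
    rw [Finset.sum_comm]
    refine Finset.sum_congr rfl fun y _ => ?_
    rw [← hμstat y, Finset.sum_mul]
    exact Finset.sum_congr rfl fun x _ => by ring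
  let T : (A → ℝ) →ₗ[ℝ] (A → ℝ) :=
    { toFun := fun g x => g x - ∑ y, Q x y * g y + ∑ y, μ y * g y
      map_add' := by
        intro f g; funext x
        simp only [Pi.add_apply, mul_add, Finset.sum_add_distrib]; ring
      map_smul' := by
        intro c g; funext x
        simp only [Pi.smul_apply, smul_eq_mul, RingHom.id_apply]
        rw [mul_add, mul_sub, Finset.mul_sum, Finset.mul_sum]
        congr 1
        · congr 1
          exact Finset.sum_congr rfl fun y _ => by ring
        · exact Finset.sum_congr rfl fun y _ => by ring }
  have hT : ∀ g x, T g x = g x - ∑ y, Q x y * g y + ∑ y, μ y * g y := fun _ _ => rfl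
  have hmu : ∀ g, ∑ x, μ x * T g x = ∑ y, μ y * g y := by
    intro g
    simp_rw [hT, mul_add, mul_sub]
    rw [Finset.sum_add_distrib, Finset.sum_sub_distrib, hstat, ← Finset.sum_mul, hμsum]
    ring
  have hinj : Function.Injective T := by
    rw [injective_iff_map_eq_zero]
    intro g hg
    have h0 : ∑ y, μ y * g y = 0 := by rw [← hmu g, hg]; simp
    have h1 : ∀ x, ∑ y, Q x y * g y = g x := by
      intro x
      have := congrFun hg x
      rw [hT, h0] at this
      simp only [Pi.zero_apply] at this
      linarith
    obtain ⟨z, hz⟩ := Finite.exists_max g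
    have h2 : ∑ y, Q z y * (g z - g y) = 0 := by
      simp_rw [mul_sub]
      rw [Finset.sum_sub_distrib, ← Finset.sum_mul, hQrow, h1]; ring
    have h3 : ∀ y, g y = g z := by
      intro y
      have := (Finset.sum_eq_zero_iff_of_nonneg
        (fun y _ => mul_nonneg (hQpos z y).le (sub_nonneg.2 (hz y)))).1 h2 y (Finset.mem_univ y)
      rcases mul_eq_zero.1 this with h | h
      · exact absurd h (hQpos z y).ne'
      · linarith
    simp_rw [h3] at h0
    rw [← Finset.sum_mul, hμsum, one_mul] at h0
    funext y
    rw [h3 y, h0]; rfl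
  obtain ⟨g, hg⟩ := (LinearMap.injective_iff_surjective.1 hinj) F
  refine ⟨g, fun x => ?_⟩
  have h0 := hmu g
  rw [hg, hF] at h0
  rw [← hg, hT, ← h0]; ring


/-- The left shift. -/
def shiftMap (ω : ℕ → A) : ℕ → A := fun i => ω (i + 1)

lemma shiftMap_iter (k : ℕ) (ω : ℕ → A) (i : ℕ) : (shiftMap^[k] ω) i = ω (k + i) := by
  induction k generalizing ω with
  | zero => simp
  | succ k ih =>
    rw [Function.iterate_succ_apply, ih]
    simp only [shiftMap]
    congr 1; omega

lemma measurableSet_cyl [MeasurableSpace A] [MeasurableSingletonClass A] (n : ℕ) (a : ℕ → A) :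
    MeasurableSet {ω : ℕ → A | ∀ i ≤ n, ω i = a i} := by
  have : {ω : ℕ → A | ∀ i ≤ n, ω i = a i} = ⋂ i ∈ Set.Iic n, (fun ω : ℕ → A => ω i) ⁻¹' {a i} := by
    ext ω; simp
  rw [this]
  exact MeasurableSet.biInter (Set.to_countable _)
    fun i _ => measurable_pi_apply i (measurableSet_singleton _)

lemma shift_preserving [Fintype A] [MeasurableSpace A] [MeasurableSingletonClass A]
    (Q : A → A → ℝ) (μ : A → ℝ)
    (hμstat : ∀ y, ∑ x, μ x * Q x y = μ y)
    (P : Measure (ℕ → A)) [IsProbabilityMeasure P]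
    (hP : ∀ (n : ℕ) (a : ℕ → A),
      (P {ω | ∀ i ≤ n, ω i = a i}).toReal
        = μ (a 0) * ∏ i ∈ Finset.range n, Q (a i) (a (i + 1))) :
    MeasurePreserving (shiftMap (A := A)) P P := by
  have hT : Measurable (shiftMap (A := A)) :=
    measurable_pi_lambda _ fun i => measurable_pi_apply (i + 1)
  refine ⟨hT, ?_⟩
  have : IsProbabilityMeasure (P.map (shiftMap (A := A))) :=
    Measure.isProbabilityMeasure_map hT.aemeasurable
  have hcyl : ∀ (N : ℕ) (a : ℕ → A),
      P (shiftMap ⁻¹' {ω | ∀ i ≤ N, ω i = a i}) = P {ω | ∀ i ≤ N, ω i = a i} := by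
    intro N a
    let c : A → ℕ → A := fun x i => Nat.casesOn i x a
    have e : shiftMap ⁻¹' {ω | ∀ i ≤ N, ω i = a i}
        = ⋃ x ∈ (Finset.univ : Finset A), {ω | ∀ i ≤ N + 1, ω i = c x i} := by
      ext ω
      simp only [Set.mem_preimage, Set.mem_ofPred_eq, Set.mem_iUnion, Finset.mem_univ,
        exists_true_left, shiftMap]
      constructor
      · intro h
        refine ⟨ω 0, fun i hi => ?_⟩
        cases i with
        | zero => rfl
        | succ i => exact h i (by omega)
      · rintro ⟨x, h⟩ i hi
        exact h (i + 1) (by omega)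
    have hreal : P.real (shiftMap ⁻¹' {ω | ∀ i ≤ N, ω i = a i})
        = P.real {ω | ∀ i ≤ N, ω i = a i} := by
      rw [e, measureReal_biUnion_finset]
      · have h1 : ∀ x, P.real {ω | ∀ i ≤ N + 1, ω i = c x i}
            = (μ x * Q x (a 0)) * ∏ i ∈ Finset.range N, Q (a i) (a (i + 1)) := by
          intro x
          refine (hP (N + 1) (c x)).trans ?_
          rw [Finset.prod_range_succ']
          change μ x * ((∏ i ∈ Finset.range N, Q (a i) (a (i + 1))) * Q x (a 0)) = _
          ring
        simp_rw [h1]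
        rw [← Finset.sum_mul, hμstat]
        exact (hP N a).symm
      · intro x _ y _ hxy
        rw [Function.onFun, Set.disjoint_left]
        intro ω hx hy
        exact hxy ((hx 0 (by omega)).symm.trans (hy 0 (by omega)))
      · intro x _
        exact measurableSet_cyl _ _
    rw [measureReal_def, measureReal_def] at hreal
    exact (ENNReal.toReal_eq_toReal_iff' (measure_ne_top _ _) (measure_ne_top _ _)).1 hreal
  have hr : ∀ N, (P.map shiftMap).map (fun (ω : ℕ → A) (j : Fin (N + 1)) => ω j)
      = P.map (fun (ω : ℕ → A) (j : Fin (N + 1)) => ω j) := by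
    intro N
    have hrm : Measurable (fun (ω : ℕ → A) (j : Fin (N + 1)) => ω j) :=
      measurable_pi_lambda _ fun i => measurable_pi_apply _
    refine Measure.ext_of_singleton fun a => ?_
    have e : (fun (ω : ℕ → A) (j : Fin (N + 1)) => ω j) ⁻¹' {a}
        = {ω | ∀ i ≤ N, ω i = perExt N a i} := by
      ext ω
      simp only [Set.mem_preimage, Set.mem_singleton_iff, Set.mem_ofPred_eq]
      constructor
      · rintro rfl i hi
        rw [perExt_of_le N ω i hi]
      · intro h
        funext j
        rw [h j (by omega)]
        unfold perExt
        congr 1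
        ext
        simp [Nat.mod_eq_of_lt j.2]
    rw [Measure.map_apply hrm (measurableSet_singleton _),
      Measure.map_apply hrm (measurableSet_singleton _), e,
      Measure.map_apply hT (measurableSet_cyl _ _), hcyl]
  refine ext_of_generate_finite (measurableCylinders fun _ : ℕ => A)
    generateFrom_measurableCylinders.symm isPiSystem_measurableCylinders ?_ (by simp)
  intro s hs
  rw [mem_measurableCylinders] at hs
  obtain ⟨I, S, hS, rfl⟩ := hs
  have hI : ∀ i : I, (i : ℕ) < I.sup id + 1 := fun i =>
    Nat.lt_succ_of_le (Finset.le_sup (f := id) i.2)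
  have hrm : Measurable (fun (ω : ℕ → A) (j : Fin (I.sup id + 1)) => ω j) :=
    measurable_pi_lambda _ fun i => measurable_pi_apply _
  have e : cylinder I S = (fun (ω : ℕ → A) (j : Fin (I.sup id + 1)) => ω j) ⁻¹'
      {b | (fun i : I => b ⟨i, hI i⟩) ∈ S} := by
    ext ω
    rfl
  have hm : MeasurableSet {b : Fin (I.sup id + 1) → A | (fun i : I => b ⟨i, hI i⟩) ∈ S} :=
    MeasurableSet.of_discrete
  rw [e, ← Measure.map_apply hrm hm, ← Measure.map_apply hrm hm, hr]

lemma kac {Ω : Type*} [MeasurableSpace Ω] (P : Measure Ω) [IsProbabilityMeasure P]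
    (T : Ω → Ω) (hT : MeasurePreserving T P P) (C : Set Ω) (hC : MeasurableSet C) (K : ℕ) :
    (K + 1 : ℝ) * P.real (C ∩ {ω | ∀ k, 1 ≤ k → k ≤ K → T^[k] ω ∉ C}) ≤ 1 := by
  set B := C ∩ {ω | ∀ k, 1 ≤ k → k ≤ K → T^[k] ω ∉ C} with hB
  have hBm : MeasurableSet B := by
    have : B = C ∩ ⋂ k ∈ Set.Icc 1 K, (T^[k] ⁻¹' C)ᶜ := by
      ext ω; simp [hB]
    rw [this]
    exact hC.inter (MeasurableSet.biInter (Set.to_countable _)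
      fun k _ => ((hT.iterate k).measurable hC).compl)
  have h : P.real (⋃ j ∈ Finset.range (K + 1), T^[j] ⁻¹' B) = (K + 1 : ℝ) * P.real B := by
    rw [measureReal_biUnion_finset]
    · have : ∀ j, P.real (T^[j] ⁻¹' B) = P.real B := fun j => by
        rw [measureReal_def, (hT.iterate j).measure_preimage hBm.nullMeasurableSet, measureReal_def]
      simp [this]
    · have main : ∀ i j, i < j → j < K + 1 → Disjoint (T^[i] ⁻¹' B) (T^[j] ⁻¹' B) := by
        intro i j hij hj
        rw [Set.disjoint_left]
        intro ω hi hj'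
        refine hi.2 (j - i) (by omega) (by omega) ?_
        rw [← Function.iterate_add_apply, Nat.sub_add_cancel hij.le]
        exact hj'.1
      intro i hi j hj hij
      have hi' := Finset.mem_range.1 hi
      have hj' := Finset.mem_range.1 hj
      rcases lt_or_gt_of_ne hij with h | h
      · exact main i j h hj'
      · exact (main j i h hi').symm
    · intro j _
      exact (hT.iterate j).measurable hBm
  rw [← h]
  exact measureReal_le_one

lemma upper_event [Fintype A] [MeasurableSpace A] [MeasurableSingletonClass A]
    (Q : A → A → ℝ) (μ : A → ℝ)
    (hQpos : ∀ x y, 0 < Q x y)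
    (hQrow : ∀ x, ∑ y, Q x y = 1)
    (hμstat : ∀ y, ∑ x, μ x * Q x y = μ y)
    (P : Measure (ℕ → A)) [IsProbabilityMeasure P]
    (hP : ∀ (n : ℕ) (a : ℕ → A),
      (P {ω | ∀ i ≤ n, ω i = a i}).toReal
        = μ (a 0) * ∏ i ∈ Finset.range n, Q (a i) (a (i + 1)))
    (l : ℕ) (c : ℝ) (hc : 0 < c) :
    P.real {ω | ∀ k : ℕ, 1 ≤ k → (∀ i < l + 1, ω (k + i) = ω i) → c / pathProd Q l ω < k}
      ≤ Fintype.card A * c⁻¹ := by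
  have hQ0 : ∀ x y, 0 ≤ Q x y := fun x y => (hQpos x y).le
  have hpos : ∀ ω, 0 < pathProd Q l ω := fun ω => Finset.prod_pos fun _ _ => hQpos _ _
  let C : (Fin (l + 1) → A) → Set (ℕ → A) := fun a => {ω | ∀ i ≤ l, ω i = perExt l a i}
  let K : (Fin (l + 1) → A) → ℕ := fun a => ⌊c / pathProd Q l (perExt l a)⌋₊
  let B : (Fin (l + 1) → A) → Set (ℕ → A) := fun a =>
    C a ∩ {ω | ∀ k, 1 ≤ k → k ≤ K a → shiftMap^[k] ω ∉ C a}
  have hB : ∀ a, P.real (B a) ≤ pathProd Q l (perExt l a) * c⁻¹ := by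
    intro a
    have h1 := kac P shiftMap (shift_preserving Q μ hμstat P hP) (C a) (measurableSet_cyl _ _) (K a)
    have h2 : c / pathProd Q l (perExt l a) < K a + 1 := Nat.lt_floor_add_one _
    have h3 : c / pathProd Q l (perExt l a) * P.real (B a) ≤ 1 :=
      (mul_le_mul_of_nonneg_right h2.le measureReal_nonneg).trans h1
    have h4 := hpos (perExt l a)
    rw [div_mul_eq_mul_div, div_le_one h4] at h3
    rw [← div_eq_mul_inv, le_div_iff₀ hc]
    linarith
  have hsub : {ω | ∀ k : ℕ, 1 ≤ k → (∀ i < l + 1, ω (k + i) = ω i) → c / pathProd Q l ω < k}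
      ⊆ ⋃ a ∈ (Finset.univ : Finset (Fin (l + 1) → A)), B a := by
    intro ω hω
    simp only [Set.mem_iUnion, Finset.mem_univ, exists_true_left]
    have hper : ∀ i ≤ l, ω i = perExt l (fun j => ω j) i :=
      fun i hi => (perExt_of_le l ω i hi).symm
    refine ⟨fun j => ω j, hper, ?_⟩
    intro k hk hkK hmem
    have h1 := hω k hk (fun i hi => by
      have := hmem i (by omega)
      rw [shiftMap_iter] at this
      rw [this, ← hper i (by omega)])
    have h2 : (k : ℝ) ≤ c / pathProd Q l (perExt l (fun j => ω j)) :=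
      (Nat.le_floor_iff (div_pos hc (hpos _)).le).1 hkK
    rw [← pathProd_congr Q l ω _ hper] at h2
    linarith
  refine (measureReal_mono hsub (measure_ne_top _ _)).trans
    ((measureReal_biUnion_finset_le _ _).trans ?_)
  refine (Finset.sum_le_sum fun a _ => hB a).trans ?_
  rw [← Finset.sum_mul]
  refine mul_le_mul_of_nonneg_right ?_ (inv_pos.2 hc).le
  have := sum_pathProd_le Q hQ0 1 (fun x => (hQrow x).le) (fun _ => 1) (fun _ => zero_le_one)
    zero_le_one l
  simpa using this

lemma entropy_event [Fintype A] [Nonempty A] [MeasurableSpace A] (Q : A → A → ℝ) (μ : A → ℝ)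
    (hQpos : ∀ x y, 0 < Q x y)
    (hQrow : ∀ x, ∑ y, Q x y = 1)
    (hμnonneg : ∀ x, 0 ≤ μ x) (hμsum : ∑ x, μ x = 1)
    (hμstat : ∀ y, ∑ x, μ x * Q x y = μ y)
    (P : Measure (ℕ → A)) [IsProbabilityMeasure P]
    (hP : ∀ (n : ℕ) (a : ℕ → A),
      (P {ω | ∀ i ≤ n, ω i = a i}).toReal
        = μ (a 0) * ∏ i ∈ Finset.range n, Q (a i) (a (i + 1)))
    (h : ℝ) (hh : h = - ∑ x, ∑ y, μ x * Q x y * Real.log (Q x y)) (ε : ℝ) (hε : 0 < ε) :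
    ∀ᵐ ω ∂P, ∀ᶠ l : ℕ in atTop,
      |-Real.log (pathProd Q l ω) - (l + 1) * h| ≤ ε * (l + 1) := by
  have hF : ∑ x, μ x * (∑ y, Q x y * (-Real.log (Q x y) - h)) = 0 := by
    have : ∀ x, μ x * (∑ y, Q x y * (-Real.log (Q x y) - h))
        = -(∑ y, μ x * Q x y * Real.log (Q x y)) - μ x * h := by
      intro x
      simp_rw [mul_sub]
      rw [Finset.sum_sub_distrib, ← Finset.sum_mul, hQrow, mul_sub, one_mul, Finset.mul_sum,
        ← Finset.sum_neg_distrib]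
      congr 1
      exact Finset.sum_congr rfl fun y _ => by ring
    simp_rw [this]
    rw [Finset.sum_sub_distrib, ← Finset.sum_mul, hμsum, Finset.sum_neg_distrib, ← hh]
    ring
  obtain ⟨g, hg⟩ := poisson Q μ hQpos hQrow hμsum hμstat _ hF
  let D : A → A → ℝ := fun x y => -Real.log (Q x y) - h + g y - g x
  have hD : ∀ x, ∑ y, Q x y * D x y = 0 := by
    intro x
    have : ∀ y, Q x y * D x y = Q x y * (-Real.log (Q x y) - h) + Q x y * g y - Q x y * g x :=
      fun y => by simp only [D]; ring
    simp_rw [this]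
    rw [Finset.sum_sub_distrib, Finset.sum_add_distrib, ← Finset.sum_mul, hQrow, ← hg x]
    ring
  have hD' : ∀ x, ∑ y, Q x y * (-D x y) = 0 := by
    intro x
    simp_rw [mul_neg]
    rw [Finset.sum_neg_distrib, hD, neg_zero]
  obtain ⟨z, hz⟩ := Finite.exists_max (fun x => |g x|)
  have hsum : ∀ (ω : ℕ → A) (l : ℕ), ∑ i ∈ Finset.range l, D (ω i) (ω (i + 1))
      = -Real.log (pathProd Q l ω) - l * h + g (ω l) - g (ω 0) := by
    intro ω l
    have h1 : Real.log (pathProd Q l ω) = ∑ i ∈ Finset.range l, Real.log (Q (ω i) (ω (i + 1))) :=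
      Real.log_prod fun i _ => (hQpos _ _).ne'
    rw [h1]
    induction l with
    | zero => simp
    | succ l ih =>
      have h1 : Real.log (pathProd Q l ω) = ∑ i ∈ Finset.range l, Real.log (Q (ω i) (ω (i + 1))) :=
        Real.log_prod fun i _ => (hQpos _ _).ne'
      rw [Finset.sum_range_succ, ih h1, Finset.sum_range_succ]
      simp only [D]
      push_cast
      ring
  have hu := lln_upper Q μ hQpos hQrow hμnonneg hμsum P hP D hD (ε / 2) (by positivity)
  have hl := lln_upper Q μ hQpos hQrow hμnonneg hμsum P hP (fun x y => -D x y) hD' (ε / 2)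
    (by positivity)
  filter_upwards [hu, hl] with ω h1 h2
  have hbig : ∀ᶠ l : ℕ in atTop, (2 * |g z| + |h|) / (ε / 2) ≤ (l : ℝ) :=
    tendsto_natCast_atTop_atTop.eventually_ge_atTop _
  filter_upwards [h1, h2, hbig] with l h1 h2 h3
  rw [Finset.sum_neg_distrib, hsum] at h2
  rw [hsum] at h1
  rw [div_le_iff₀ (by positivity)] at h3
  have a1 := abs_le.1 (hz (ω l))
  have a2 := abs_le.1 (hz (ω 0))
  have a3 := neg_abs_le h
  have a4 := le_abs_self h
  rw [abs_le]
  constructor <;> linarith [a1.1, a1.2, a2.1, a2.2]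

end helpers

/-- Ornstein–Weiss for stationary Markov chains with strictly positive transition matrix. -/
theorem stmt0
    {A : Type*} [Fintype A] [Nonempty A] [MeasurableSpace A] [MeasurableSingletonClass A]
    (Q : A → A → ℝ) (μ : A → ℝ)
    (hQpos : ∀ x y, 0 < Q x y)
    (hQrow : ∀ x, ∑ y, Q x y = 1)
    (hμnonneg : ∀ x, 0 ≤ μ x) (hμsum : ∑ x, μ x = 1)
    (hμstat : ∀ y, ∑ x, μ x * Q x y = μ y)
    (P : Measure (ℕ → A)) [IsProbabilityMeasure P]
    (hP : ∀ (n : ℕ) (a : ℕ → A),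
      (P {ω | ∀ i ≤ n, ω i = a i}).toReal
        = μ (a 0) * ∏ i ∈ Finset.range n, Q (a i) (a (i + 1))) :
    ∀ᵐ ω ∂P, Tendsto (fun n : ℕ => Real.log (returnTime n ω) / n) atTop
      (nhds (- ∑ x, ∑ y, μ x * Q x y * Real.log (Q x y))) := by
  obtain ⟨h, hh⟩ : ∃ h : ℝ, h = - ∑ x, ∑ y, μ x * Q x y * Real.log (Q x y) := ⟨_, rfl⟩
  rw [← hh]
  have hpos : ∀ l ω, 0 < pathProd Q l ω := fun l ω => Finset.prod_pos fun _ _ => hQpos _ _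
  have main : ∀ ε : ℝ, 0 < ε → ∀ᵐ ω ∂P, ∀ᶠ l : ℕ in atTop,
      |Real.log (returnTime (l + 1) ω) / ((l + 1 : ℕ) : ℝ) - h| ≤ 2 * ε := by
    intro ε hε
    have hexp : Real.exp (-ε) < 1 := by rw [Real.exp_lt_one_iff]; linarith
    have hexpl : ∀ l : ℕ, Real.exp (-(ε * (l + 1))) ≤ Real.exp (-ε) ^ l := by
      intro l
      rw [← Real.exp_nat_mul]
      apply Real.exp_le_exp.2
      nlinarith
    have e1 := entropy_event Q μ hQpos hQrow hμnonneg hμsum hμstat P hP h hh ε hε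
    have e2 := ae_of_real_le P (fun l => {ω | ∀ k : ℕ, 1 ≤ k → (∀ i < l + 1, ω (k + i) = ω i) →
        Real.exp (ε * (l + 1)) / pathProd Q l ω < k}) (Fintype.card A) (Real.exp (-ε))
        (Real.exp_pos _).le hexp (by
          intro l
          refine (upper_event Q μ hQpos hQrow hμstat P hP l _ (Real.exp_pos _)).trans ?_
          rw [← Real.exp_neg]
          exact mul_le_mul_of_nonneg_left (hexpl l) (Nat.cast_nonneg _))
    have e3 := ae_of_real_le P (fun l => ⋃ m ∈ Finset.range ⌊Real.exp ((l + 1) * (h - 2 * ε))⌋₊,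
        {ω | (∀ i < l + 1, ω (m + 1 + i) = ω i) ∧
          pathProd Q l ω ≤ Real.exp (-((l + 1) * (h - ε)))}) 1 (Real.exp (-ε))
        (Real.exp_pos _).le hexp (by
          intro l
          refine (measureReal_biUnion_finset_le _ _).trans ?_
          refine (Finset.sum_le_sum fun m _ => match_le Q μ hQpos hQrow hμnonneg hμsum P hP m l _
            (Real.exp_pos _).le).trans ?_
          rw [Finset.sum_const, Finset.card_range, nsmul_eq_mul, one_mul]
          refine (mul_le_mul_of_nonneg_right (Nat.floor_le (Real.exp_pos _).le)
            (Real.exp_pos _).le).trans ?_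
          refine le_trans (le_of_eq ?_) (hexpl l)
          rw [← Real.exp_add]
          congr 1; ring)
    filter_upwards [e1, e2, e3] with ω e1 e2 e3
    filter_upwards [e1, e2, e3] with l e1 e2 e3
    have hl : (0 : ℝ) < (l : ℝ) + 1 := by positivity
    obtain ⟨e1a, e1b⟩ := abs_le.1 e1
    simp only [Set.mem_ofPred_eq, not_forall, not_lt] at e2
    obtain ⟨k, hk1, hkm, hk⟩ := e2
    have hmem : k ∈ {k | 1 ≤ k ∧ ∀ i < l + 1, ω (k + i) = ω i} := ⟨hk1, hkm⟩
    have hR := Nat.sInf_mem ⟨k, hmem⟩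
    have hRk : returnTime (l + 1) ω ≤ k := Nat.sInf_le hmem
    change 1 ≤ returnTime (l + 1) ω ∧ ∀ i < l + 1, ω (returnTime (l + 1) ω + i) = ω i at hR
    obtain ⟨hR1, hR2⟩ := hR
    have hRpos : (0 : ℝ) < returnTime (l + 1) ω := by exact_mod_cast hR1
    have up : Real.log (returnTime (l + 1) ω) ≤ (l + 1) * (h + 2 * ε) := by
      have : Real.log (returnTime (l + 1) ω) ≤ Real.log (Real.exp (ε * (l + 1)) / pathProd Q l ω) :=
        Real.log_le_log hRpos (le_trans (by exact_mod_cast hRk) hk)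
      rw [Real.log_div (Real.exp_pos _).ne' (hpos l ω).ne', Real.log_exp] at this
      linarith
    have lo : (l + 1) * (h - 2 * ε) ≤ Real.log (returnTime (l + 1) ω) := by
      by_contra hcon
      push Not at hcon
      rw [Real.log_lt_iff_lt_exp hRpos] at hcon
      apply e3
      simp only [Set.mem_iUnion]
      refine ⟨returnTime (l + 1) ω - 1, ?_, ?_, ?_⟩
      · rw [Finset.mem_range]
        have := Nat.le_floor hcon.le
        omega
      · rw [Nat.sub_add_cancel hR1]
        exact hR2
      · rw [← Real.log_le_iff_le_exp (hpos l ω)]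
        linarith
    push_cast
    rw [abs_le]
    constructor
    · have : h - 2 * ε ≤ Real.log (returnTime (l + 1) ω) / (l + 1) := by
        rw [le_div_iff₀ hl]; linarith
      linarith
    · have : Real.log (returnTime (l + 1) ω) / (l + 1) ≤ h + 2 * ε := by
        rw [div_le_iff₀ hl]; linarith
      linarith
  have hall := ae_all_iff.2 fun m : ℕ => main (1 / ((m : ℝ) + 1)) (by positivity)
  filter_upwards [hall] with ω hω
  rw [← tendsto_add_atTop_iff_nat 1, Metric.tendsto_atTop']
  intro δ hδ
  obtain ⟨m, hm⟩ := exists_nat_one_div_lt (show 0 < δ / 2 by positivity)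
  obtain ⟨N, hN⟩ := eventually_atTop.1 (hω m)
  refine ⟨N, fun n hn => ?_⟩
  rw [Real.dist_eq]
  have := hN n hn.le
  linarith
end

section
/- Let A be a nonempty finite set, let Q_X and Q_Y be strictly positive stochastic matrices on A with stationary probability vectors mu and mu~ respectively, and let P, P~ be the stationary Markov measures determined by (Q_X, mu) and (Q_Y, mu~). Then there exist kappa_1, kappa_2 > 0 such that for (P tensor P~)-almost every pair (X, Y), for all sufficiently large n: - kappa_1 log n <= log( W_n(X|Y) * P~_n(X_1,...,X_n) ) <= log( kappa_2 log n ), where P~_n(X_1,...,X_n) denotes the P~-probability of the cylinder {omega : omega_i = X_i, 1 <= i <= n}. The same statement holds with the pair (P~, Q_Y) replaced by an independent copy (P, Q_X), i.e. for W_n(X|X') under P tensor P. -/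
open MeasureTheory Filter Finset Real

/-- Probability of the cylinder determined by the word `a_1, …, a_n` (coordinates `1 ≤ i ≤ n`). -/
noncomputable def cylProb {A : Type*} [MeasurableSpace A]
    (P : Measure (ℕ → A)) (n : ℕ) (a : ℕ → A) : ℝ :=
  (P {ω | ∀ i, 1 ≤ i → i ≤ n → ω i = a i}).toReal

/-- Waiting time: `W_n(x|y) = inf { k ≥ 1 : y_{k+i} = x_i for all 1 ≤ i ≤ n }`
(with the convention `sInf ∅ = 0` in `ℕ`; the set is a.s. nonempty). -/
noncomputable def waitingTime {A : Type*} (n : ℕ) (x y : ℕ → A) : ℕ :=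
  sInf {k | 1 ≤ k ∧ ∀ i, 1 ≤ i → i ≤ n → y (k + i) = x i}

/-- occurrence of the word `b_0..b_N` at position `j` -/
def MOcc {A : Type*} (b : ℕ → A) (N j : ℕ) : Set (ℕ → A) := {y | ∀ i ≤ N, y (j + i) = b i}

/-- the event `E` is determined by the coordinates `≤ t` -/
def MDet {A : Type*} (t : ℕ) (E : Set (ℕ → A)) : Prop :=
  ∀ y y' : ℕ → A, (∀ i ≤ t, y i = y' i) → y ∈ E → y' ∈ E

/-- no occurrence at positions `2..m` -/
def MNo {A : Type*} (b : ℕ → A) (N m : ℕ) : Set (ℕ → A) :=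
  {y | ∀ j, 2 ≤ j → j ≤ m → y ∉ MOcc b N j}

lemma MDet.mono {A : Type*} {t t' : ℕ} {E : Set (ℕ → A)} (h : MDet t E) (htt : t ≤ t') :
    MDet t' E := fun y y' hy => h y y' (fun i hi => hy i (hi.trans htt))

lemma MDet.inter {A : Type*} {t : ℕ} {E F : Set (ℕ → A)} (h : MDet t E) (h' : MDet t F) :
    MDet t (E ∩ F) := fun y y' hy hm => ⟨h y y' hy hm.1, h' y y' hy hm.2⟩

lemma MDet.occ {A : Type*} (b : ℕ → A) (N j : ℕ) : MDet (j + N) (MOcc b N j) := by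
  intro y y' h hy i hi
  rw [← h (j + i) (by omega)]
  exact hy i hi

lemma MDet.no {A : Type*} (b : ℕ → A) (N m : ℕ) : MDet (m + N) (MNo b N m) := by
  intro y y' h hy j h2 hj hocc
  exact hy j h2 hj (MDet.occ b N j y' y (fun i hi => (h i (by omega)).symm) hocc)

lemma measurableSet_MOcc {A : Type*} [MeasurableSpace A] [MeasurableSingletonClass A]
    (b : ℕ → A) (N j : ℕ) : MeasurableSet (MOcc b N j) := by
  have : MOcc b N j = ⋂ i, ⋂ (_ : i ≤ N), (fun y : ℕ → A => y (j + i)) ⁻¹' {b i} := by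
    ext y; simp [MOcc]
  rw [this]
  exact MeasurableSet.iInter fun i => MeasurableSet.iInter fun _ =>
    measurable_pi_apply _ (measurableSet_singleton _)

lemma real_split {Ω β : Type*} [MeasurableSpace Ω] [Fintype β] (P : Measure Ω)
    [IsProbabilityMeasure P] (f : Ω → β) (hf : ∀ b, MeasurableSet (f ⁻¹' {b})) (S : Set Ω) :
    P.real S = ∑ b, P.real (S ∩ f ⁻¹' {b}) := by
  have := sum_measureReal_preimage_singleton (μ := P.restrict S) Finset.univ
    (f := f) (fun y _ => hf y)
  simp only [Finset.coe_univ, Set.preimage_univ] at this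
  rw [measureReal_restrict_apply MeasurableSet.univ, Set.univ_inter] at this
  rw [← this]
  refine Finset.sum_congr rfl fun b _ => ?_
  rw [measureReal_restrict_apply (hf b), Set.inter_comm]

section markov
set_option linter.unusedSectionVars false
variable {A : Type*} [Fintype A] [MeasurableSpace A] [MeasurableSingletonClass A]
  {Q : A → A → ℝ} {μ : A → ℝ} {P : Measure (ℕ → A)} [IsProbabilityMeasure P]

lemma fiber_meas (t : ℕ) (u : Fin (t + 1) → A) :
    MeasurableSet ((fun (y : ℕ → A) (i : Fin (t + 1)) => y i) ⁻¹' {u}) :=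
  (measurable_pi_lambda _ fun _ => measurable_pi_apply _) (measurableSet_singleton u)

lemma onestep (hP : ∀ (n : ℕ) (a : ℕ → A), (P {ω | ∀ i ≤ n, ω i = a i}).toReal
        = μ (a 0) * ∏ i ∈ Finset.range n, Q (a i) (a (i + 1)))
    {E : Set (ℕ → A)} {t : ℕ} (hE : MDet t E) (s b : A) :
    P.real (E ∩ {y | y t = s} ∩ {y | y (t + 1) = b}) = P.real (E ∩ {y | y t = s}) * Q s b := by
  rw [real_split P _ (fiber_meas t) (E ∩ {y | y t = s} ∩ {y | y (t + 1) = b}),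
    real_split P _ (fiber_meas t) (E ∩ {y | y t = s}), Finset.sum_mul]
  refine Finset.sum_congr rfl fun u _ => ?_
  set a : ℕ → A := fun i => if h : i < t + 1 then u ⟨i, h⟩ else b with ha
  have hau : ∀ i : Fin (t + 1), a i = u i := fun i => by
    simp only [ha]
    rw [dif_pos i.2]
  have hfib : ∀ y : ℕ → A, (y ∈ (fun (y : ℕ → A) (i : Fin (t + 1)) => y i) ⁻¹' {u}) ↔
      ∀ i ≤ t, y i = a i := by
    intro y
    simp only [Set.mem_preimage, Set.mem_singleton_iff]
    constructor
    · rintro h i hi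
      have := congrFun h ⟨i, by omega⟩
      simp only at this
      rw [this, ← hau]
    · intro h
      funext i
      rw [h i (by omega), hau]
  have hab : a (t + 1) = b := by simp [ha]
  by_cases hc : a ∈ E ∧ a t = s
  · have h1 : E ∩ {y | y t = s} ∩ (fun (y : ℕ → A) (i : Fin (t + 1)) => y i) ⁻¹' {u}
        = {ω | ∀ i ≤ t, ω i = a i} := by
      ext y
      rw [Set.mem_inter_iff, hfib]
      constructor
      · exact fun h => h.2
      · intro h
        refine ⟨⟨hE a y (fun i hi => (h i hi).symm) hc.1, ?_⟩, h⟩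
        exact (h t le_rfl).trans hc.2
    have h2 : E ∩ {y | y t = s} ∩ {y | y (t + 1) = b} ∩
        (fun (y : ℕ → A) (i : Fin (t + 1)) => y i) ⁻¹' {u} = {ω | ∀ i ≤ t + 1, ω i = a i} := by
      rw [Set.inter_right_comm, h1]
      ext y
      constructor
      · rintro ⟨h, h'⟩ i hi
        rcases Nat.lt_or_ge t i with h3 | h3
        · obtain rfl : i = t + 1 := by omega
          rw [hab]; exact h'
        · exact h i h3
      · intro h
        refine ⟨fun i hi => h i (by omega), ?_⟩
        exact (h (t + 1) le_rfl).trans hab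
    rw [h1, h2, measureReal_def, measureReal_def, hP, hP, Finset.prod_range_succ, hab, hc.2,
      mul_assoc]
  · have h1 : E ∩ {y | y t = s} ∩ (fun (y : ℕ → A) (i : Fin (t + 1)) => y i) ⁻¹' {u} = ∅ := by
      ext y
      rw [Set.mem_inter_iff, hfib]
      simp only [Set.mem_empty_iff_false, iff_false]
      rintro ⟨⟨h, h'⟩, h3⟩
      exact hc ⟨hE y a h3 h, (h3 t le_rfl).symm.trans h'⟩
    rw [Set.inter_right_comm, h1]
    simp

lemma meas_coord (t : ℕ) (s : A) : MeasurableSet ((fun y : ℕ → A => y t) ⁻¹' {s}) :=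
  measurable_pi_apply _ (measurableSet_singleton _)

lemma onestep_sum (hP : ∀ (n : ℕ) (a : ℕ → A), (P {ω | ∀ i ≤ n, ω i = a i}).toReal
        = μ (a 0) * ∏ i ∈ Finset.range n, Q (a i) (a (i + 1)))
    {E : Set (ℕ → A)} {t : ℕ} (hE : MDet t E) (b : A) :
    P.real (E ∩ {y | y (t + 1) = b}) = ∑ s, P.real (E ∩ {y | y t = s}) * Q s b := by
  rw [real_split P _ (meas_coord t)]
  refine Finset.sum_congr rfl fun s _ => ?_
  rw [← onestep hP hE, Set.inter_right_comm]
  rfl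

lemma onestep_le (hP : ∀ (n : ℕ) (a : ℕ → A), (P {ω | ∀ i ≤ n, ω i = a i}).toReal
        = μ (a 0) * ∏ i ∈ Finset.range n, Q (a i) (a (i + 1)))
    {ρ : ℝ} (hρ : ∀ x y, Q x y ≤ ρ)
    {E : Set (ℕ → A)} {t : ℕ} (hE : MDet t E) (b : A) :
    P.real (E ∩ {y | y (t + 1) = b}) ≤ P.real E * ρ := by
  rw [onestep_sum hP hE, real_split P _ (meas_coord t) E, Finset.sum_mul]
  exact Finset.sum_le_sum fun s _ => mul_le_mul_of_nonneg_left (hρ _ _) measureReal_nonneg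

lemma le_onestep (hP : ∀ (n : ℕ) (a : ℕ → A), (P {ω | ∀ i ≤ n, ω i = a i}).toReal
        = μ (a 0) * ∏ i ∈ Finset.range n, Q (a i) (a (i + 1)))
    {q : ℝ} (hq : ∀ x y, q ≤ Q x y)
    {E : Set (ℕ → A)} {t : ℕ} (hE : MDet t E) (b : A) :
    P.real E * q ≤ P.real (E ∩ {y | y (t + 1) = b}) := by
  rw [onestep_sum hP hE, real_split P _ (meas_coord t) E, Finset.sum_mul]
  exact Finset.sum_le_sum fun s _ => mul_le_mul_of_nonneg_left (hq _ _) measureReal_nonneg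

lemma chain (hP : ∀ (n : ℕ) (a : ℕ → A), (P {ω | ∀ i ≤ n, ω i = a i}).toReal
        = μ (a 0) * ∏ i ∈ Finset.range n, Q (a i) (a (i + 1)))
    {E : Set (ℕ → A)} {t : ℕ} (hE : MDet t E) (b : ℕ → A) (N : ℕ) :
    P.real (E ∩ MOcc b N t) =
      P.real (E ∩ {y | y t = b 0}) * ∏ i ∈ Finset.range N, Q (b i) (b (i + 1)) := by
  induction N with
  | zero =>
    have : MOcc b 0 t = {y | y t = b 0} := by ext y; simp [MOcc]
    simp [this]
  | succ N ih =>
    have h1 : E ∩ MOcc b (N + 1) t =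
        (E ∩ MOcc b N t) ∩ {y | y (t + N) = b N} ∩ {y | y (t + N + 1) = b (N + 1)} := by
      ext y
      constructor
      · rintro ⟨h, h'⟩
        exact ⟨⟨⟨h, fun i hi => h' i (by omega)⟩, h' N (by omega)⟩, h' (N + 1) le_rfl⟩
      · rintro ⟨⟨⟨h, h'⟩, _⟩, h3⟩
        refine ⟨h, fun i hi => ?_⟩
        rcases Nat.lt_or_ge N i with h4 | h4
        · obtain rfl : i = N + 1 := by omega
          exact h3
        · exact h' i h4
    have h2 : (E ∩ MOcc b N t) ∩ {y | y (t + N) = b N} = E ∩ MOcc b N t := by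
      ext y
      exact ⟨fun h => h.1, fun h => ⟨h, h.2 N le_rfl⟩⟩
    rw [h1, onestep hP ((hE.mono (by omega)).inter (MDet.occ b N t)), h2, ih,
      Finset.prod_range_succ, mul_assoc]

lemma coord_law (hμstat : ∀ y, ∑ x, μ x * Q x y = μ y)
    (hP : ∀ (n : ℕ) (a : ℕ → A), (P {ω | ∀ i ≤ n, ω i = a i}).toReal
        = μ (a 0) * ∏ i ∈ Finset.range n, Q (a i) (a (i + 1))) (t : ℕ) (s : A) :
    P.real (Set.univ ∩ {y : ℕ → A | y t = s}) = μ s := by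
  induction t generalizing s with
  | zero =>
    have := hP 0 (fun _ => s)
    simpa [measureReal_def] using this
  | succ t ih =>
    rw [onestep_sum hP (E := Set.univ) (fun _ _ _ _ => trivial)]
    simp only [ih]
    exact hμstat s

lemma occ_law (hμstat : ∀ y, ∑ x, μ x * Q x y = μ y)
    (hP : ∀ (n : ℕ) (a : ℕ → A), (P {ω | ∀ i ≤ n, ω i = a i}).toReal
        = μ (a 0) * ∏ i ∈ Finset.range n, Q (a i) (a (i + 1))) (b : ℕ → A) (N t : ℕ) :
    P.real (MOcc b N t) = μ (b 0) * ∏ i ∈ Finset.range N, Q (b i) (b (i + 1)) := by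
  have := chain hP (E := Set.univ) (t := t) (fun _ _ _ _ => trivial) b N
  rwa [coord_law hμstat hP, Set.univ_inter] at this

lemma occ_next_le (hP : ∀ (n : ℕ) (a : ℕ → A), (P {ω | ∀ i ≤ n, ω i = a i}).toReal
        = μ (a 0) * ∏ i ∈ Finset.range n, Q (a i) (a (i + 1)))
    {q ρ : ℝ} (hq0 : 0 < q) (hq : ∀ x y, q ≤ Q x y) (hρ : ∀ x y, Q x y ≤ ρ)
    {E : Set (ℕ → A)} {t : ℕ} (hE : MDet t E) (b : ℕ → A) (N : ℕ) :
    P.real (E ∩ MOcc b N (t + 1)) ≤ P.real E * ρ ^ (N + 1) := by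
  rw [chain hP (hE.mono (Nat.le_succ t)), pow_succ', ← mul_assoc]
  have h0 : ∀ x y, 0 ≤ Q x y := fun x y => hq0.le.trans (hq x y)
  have hρ0 : 0 ≤ ρ := (h0 (b 0) (b 0)).trans (hρ _ _)
  refine mul_le_mul (onestep_le hP hρ hE _) ?_ (Finset.prod_nonneg fun i _ => h0 _ _)
    (mul_nonneg measureReal_nonneg hρ0)
  calc _ ≤ ∏ i ∈ Finset.range N, ρ := Finset.prod_le_prod (fun i _ => h0 _ _) (fun i _ => hρ _ _)
    _ = _ := by simp

lemma occ_later_le (hP : ∀ (n : ℕ) (a : ℕ → A), (P {ω | ∀ i ≤ n, ω i = a i}).toReal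
        = μ (a 0) * ∏ i ∈ Finset.range n, Q (a i) (a (i + 1)))
    (h0 : ∀ x y, 0 ≤ Q x y)
    {E : Set (ℕ → A)} {t : ℕ} (hE : MDet t E) (b : ℕ → A) (N : ℕ) :
    P.real (E ∩ MOcc b N (t + 1)) ≤ P.real E * ∏ i ∈ Finset.range N, Q (b i) (b (i + 1)) := by
  rw [chain hP (hE.mono (Nat.le_succ t))]
  exact mul_le_mul_of_nonneg_right (measureReal_mono Set.inter_subset_left)
    (Finset.prod_nonneg fun i _ => h0 _ _)

lemma le_occ_later (hP : ∀ (n : ℕ) (a : ℕ → A), (P {ω | ∀ i ≤ n, ω i = a i}).toReal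
        = μ (a 0) * ∏ i ∈ Finset.range n, Q (a i) (a (i + 1)))
    {q : ℝ} (hq0 : 0 < q) (hq : ∀ x y, q ≤ Q x y)
    {E : Set (ℕ → A)} {t : ℕ} (hE : MDet t E) (b : ℕ → A) (N : ℕ) :
    P.real E * q * ∏ i ∈ Finset.range N, Q (b i) (b (i + 1)) ≤
      P.real (E ∩ MOcc b N (t + 1)) := by
  rw [chain hP (hE.mono (Nat.le_succ t))]
  exact mul_le_mul_of_nonneg_right (le_onestep hP hq hE _)
    (Finset.prod_nonneg fun i _ => hq0.le.trans (hq _ _))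

lemma T_bound (hP : ∀ (n : ℕ) (a : ℕ → A), (P {ω | ∀ i ≤ n, ω i = a i}).toReal
        = μ (a 0) * ∏ i ∈ Finset.range n, Q (a i) (a (i + 1)))
    {q ρ : ℝ} (hq0 : 0 < q) (hq : ∀ x y, q ≤ Q x y) (hρ : ∀ x y, Q x y ≤ ρ)
    (b : ℕ → A) (N : ℕ) {k j : ℕ} (hkj : k ≤ j) :
    P.real (MNo b N (k - 1) ∩ MOcc b N k ∩ MOcc b N j) ≤
      P.real (MNo b N (k - 1) ∩ MOcc b N k) *
        (ρ ^ (j - k) + ∏ i ∈ Finset.range N, Q (b i) (b (i + 1))) := by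
  have h0 : ∀ x y, 0 ≤ Q x y := fun x y => hq0.le.trans (hq x y)
  have hρ0 : 0 ≤ ρ := (h0 (b 0) (b 0)).trans (hρ _ _)
  have hpp : 0 ≤ ∏ i ∈ Finset.range N, Q (b i) (b (i + 1)) :=
    Finset.prod_nonneg fun i _ => h0 _ _
  have hdet : MDet (k + N) (MNo b N (k - 1) ∩ MOcc b N k) :=
    ((MDet.no b N (k - 1)).mono (by omega)).inter (MDet.occ b N k)
  have hT : 0 ≤ P.real (MNo b N (k - 1) ∩ MOcc b N k) := measureReal_nonneg
  rw [mul_add]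
  rcases Nat.eq_or_lt_of_le hkj with rfl | hlt
  · have : P.real (MNo b N (k - 1) ∩ MOcc b N k ∩ MOcc b N k) ≤
      P.real (MNo b N (k - 1) ∩ MOcc b N k) := measureReal_mono Set.inter_subset_left
    simp only [Nat.sub_self, pow_zero, mul_one]
    nlinarith [mul_nonneg hT hpp]
  rcases Nat.lt_or_ge (k + N) j with h | h
  · obtain ⟨t, rfl⟩ : ∃ t, j = t + 1 := ⟨j - 1, by omega⟩
    have := occ_later_le hP h0 (hdet.mono (t' := t) (by omega)) b N
    nlinarith [mul_nonneg hT (pow_nonneg hρ0 (t + 1 - k))]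
  · have hsub : MNo b N (k - 1) ∩ MOcc b N k ∩ MOcc b N j ⊆
        MNo b N (k - 1) ∩ MOcc b N k ∩
          MOcc (fun i => b (N + 1 + i - (j - k))) (j - k - 1) (k + N + 1) := by
      refine Set.inter_subset_inter_right _ fun y hy i hi => ?_
      have := hy (N + 1 + i - (j - k)) (by omega)
      simp only
      rw [← this]
      congr 1
      omega
    have h1 := occ_next_le hP hq0 hq hρ hdet (fun i => b (N + 1 + i - (j - k))) (j - k - 1)
    rw [show j - k - 1 + 1 = j - k by omega] at h1
    have h2 := measureReal_mono (μ := P) hsub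
    nlinarith [mul_nonneg hT hpp]

lemma no_succ (b : ℕ → A) (N : ℕ) {m : ℕ} (hm : 1 ≤ m) :
    MNo b N (m + 1) = MNo b N m \ MOcc b N (m + 1) := by
  ext y
  constructor
  · intro h
    exact ⟨fun j h2 hj => h j h2 (by omega), h (m + 1) (by omega) le_rfl⟩
  · rintro ⟨h, h'⟩ j h2 hj
    rcases Nat.lt_or_ge m j with h3 | h3
    · obtain rfl : j = m + 1 := by omega
      exact h'
    · exact h j h2 h3

lemma telescope (b : ℕ → A) (N : ℕ) {m : ℕ} (hm : 1 ≤ m) (r : ℕ) :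
    ∑ k ∈ Finset.Ioc m (m + r), P.real (MNo b N (k - 1) ∩ MOcc b N k) =
      P.real (MNo b N m) - P.real (MNo b N (m + r)) := by
  induction r with
  | zero => simp
  | succ r ih =>
    rw [← add_assoc, Finset.sum_Ioc_succ_top (by omega), ih, no_succ b N (by omega),
      Nat.add_sub_cancel]
    have := measureReal_inter_add_sdiff (μ := P) (s := MNo b N (m + r))
      (measurableSet_MOcc b N (m + r + 1))
    linarith

lemma geom_part {ρ : ℝ} (hρ0 : 0 ≤ ρ) (hρ1 : ρ < 1) (s : Finset ℕ) (k : ℕ) :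
    ∑ j ∈ s, (if k ≤ j then ρ ^ (j - k) else 0) ≤ (1 - ρ)⁻¹ := by
  rw [← Finset.sum_filter, ← tsum_geometric_of_lt_one hρ0 hρ1]
  have hinj : Set.InjOn (fun j => j - k) (s.filter (fun j => k ≤ j) : Finset ℕ) := by
    intro x hx y hy hxy
    simp only [Finset.coe_filter, Set.mem_ofPred_eq] at hx hy hxy
    omega
  rw [← Finset.sum_image (f := fun i => ρ ^ i) hinj]
  exact (summable_geometric_of_lt_one hρ0 hρ1).sum_le_tsum _ (fun i _ => pow_nonneg hρ0 i)

lemma cover (b : ℕ → A) (N : ℕ) {m j : ℕ} (hm : 1 ≤ m) (hj : m < j) :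
    MNo b N m ∩ MOcc b N j ⊆
      ⋃ k ∈ Finset.Ioc m j, MNo b N (k - 1) ∩ MOcc b N k ∩ MOcc b N j := by
  classical
  rintro y ⟨hy, hyj⟩
  have hex : ∃ k, m < k ∧ y ∈ MOcc b N k := ⟨j, hj, hyj⟩
  obtain ⟨h1, h2⟩ := Nat.find_spec hex
  have h3 : Nat.find hex ≤ j := Nat.find_min' hex ⟨hj, hyj⟩
  simp only [Set.mem_iUnion, Finset.mem_Ioc]
  refine ⟨Nat.find hex, ⟨h1, h3⟩, ⟨?_, h2⟩, hyj⟩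
  intro i hi2 hik hocc
  rcases Nat.lt_or_ge m i with h4 | h4
  · exact Nat.find_min hex (m := i) (by omega) ⟨h4, hocc⟩
  · exact hy i hi2 h4 hocc

lemma decay (hP : ∀ (n : ℕ) (a : ℕ → A), (P {ω | ∀ i ≤ n, ω i = a i}).toReal
        = μ (a 0) * ∏ i ∈ Finset.range n, Q (a i) (a (i + 1)))
    {q ρ : ℝ} (hq0 : 0 < q) (hq : ∀ x y, q ≤ Q x y) (hρ : ∀ x y, Q x y ≤ ρ) (hρ1 : ρ < 1)
    (b : ℕ → A) (N : ℕ) {m : ℕ} (hm : 1 ≤ m) (K : ℕ) :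
    K * (P.real (MNo b N m) * q * ∏ i ∈ Finset.range N, Q (b i) (b (i + 1))) ≤
      (P.real (MNo b N m) - P.real (MNo b N (m + (N + K)))) *
        ((1 - ρ)⁻¹ + K * ∏ i ∈ Finset.range N, Q (b i) (b (i + 1))) := by
  have h0 : ∀ x y, 0 ≤ Q x y := fun x y => hq0.le.trans (hq x y)
  have hρ0 : 0 ≤ ρ := (h0 (b 0) (b 0)).trans (hρ _ _)
  have hpp : 0 ≤ ∏ i ∈ Finset.range N, Q (b i) (b (i + 1)) :=
    Finset.prod_nonneg fun i _ => h0 _ _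
  set pp := ∏ i ∈ Finset.range N, Q (b i) (b (i + 1)) with hppdef
  set T : ℕ → ℝ := fun k => P.real (MNo b N (k - 1) ∩ MOcc b N k) with hTdef
  have hT : ∀ k, 0 ≤ T k := fun k => measureReal_nonneg
  have hcard : (Finset.Ioc (m + N) (m + (N + K))).card = K := by
    rw [Nat.card_Ioc]; omega
  calc (K : ℝ) * (P.real (MNo b N m) * q * pp)
      = ∑ j ∈ Finset.Ioc (m + N) (m + (N + K)), P.real (MNo b N m) * q * pp := by
        rw [Finset.sum_const, hcard, nsmul_eq_mul]
    _ ≤ ∑ j ∈ Finset.Ioc (m + N) (m + (N + K)), ∑ k ∈ Finset.Ioc m (m + (N + K)),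
          T k * ((if k ≤ j then ρ ^ (j - k) else 0) + pp) := by
        refine Finset.sum_le_sum fun j hj => ?_
        rw [Finset.mem_Ioc] at hj
        obtain ⟨t, rfl⟩ : ∃ t, j = t + 1 := ⟨j - 1, by omega⟩
        refine (le_occ_later hP hq0 hq ((MDet.no b N m).mono (t' := t) (by omega)) b N).trans ?_
        refine (measureReal_mono (cover b N hm (by omega)) (measure_ne_top _ _)).trans ?_
        refine (measureReal_biUnion_finset_le _ _).trans ?_
        refine (Finset.sum_le_sum (g := fun k =>
          T k * ((if k ≤ t + 1 then ρ ^ (t + 1 - k) else 0) + pp)) fun k hk => ?_).trans ?_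
        · rw [Finset.mem_Ioc] at hk
          simp only [hk.2, if_true]
          exact T_bound hP hq0 hq hρ b N hk.2
        · refine Finset.sum_le_sum_of_subset_of_nonneg
            (Finset.Ioc_subset_Ioc_right (by omega)) fun k _ _ => ?_
          refine mul_nonneg (hT k) (add_nonneg ?_ hpp)
          split_ifs
          · exact pow_nonneg hρ0 _
          · exact le_rfl
    _ = ∑ k ∈ Finset.Ioc m (m + (N + K)), ∑ j ∈ Finset.Ioc (m + N) (m + (N + K)),
          T k * ((if k ≤ j then ρ ^ (j - k) else 0) + pp) := Finset.sum_comm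
    _ ≤ ∑ k ∈ Finset.Ioc m (m + (N + K)), T k * ((1 - ρ)⁻¹ + K * pp) := by
        refine Finset.sum_le_sum fun k _ => ?_
        rw [← Finset.mul_sum, Finset.sum_add_distrib, Finset.sum_const, hcard, nsmul_eq_mul]
        exact mul_le_mul_of_nonneg_left (by gcongr; exact geom_part hρ0 hρ1 _ k) (hT k)
    _ = _ := by rw [← Finset.sum_mul, telescope b N hm]

lemma tail_bound (hP : ∀ (n : ℕ) (a : ℕ → A), (P {ω | ∀ i ≤ n, ω i = a i}).toReal
        = μ (a 0) * ∏ i ∈ Finset.range n, Q (a i) (a (i + 1)))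
    {q : ℝ} (hq0 : 0 < q) (hq1 : q < 1) (hq : ∀ x y, q ≤ Q x y) (hρ : ∀ x y, Q x y ≤ 1 - q)
    (b : ℕ → A) (N : ℕ) :
    ∃ L : ℕ, L * ∏ i ∈ Finset.range N, Q (b i) (b (i + 1)) ≤ q⁻¹ + 2 ∧
      ∀ r : ℕ, P.real (MNo b N (1 + r * L)) ≤ (1 - q / (q⁻¹ + 2)) ^ r := by
  have hpp : 0 < ∏ i ∈ Finset.range N, Q (b i) (b (i + 1)) :=
    Finset.prod_pos fun i _ => hq0.trans_le (hq _ _)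
  have hppN : ∏ i ∈ Finset.range N, Q (b i) (b (i + 1)) ≤ (1 - q) ^ N := by
    calc _ ≤ ∏ i ∈ Finset.range N, (1 - q) :=
          Finset.prod_le_prod (fun i _ => hq0.le.trans (hq _ _)) (fun i _ => hρ _ _)
      _ = _ := by simp
  have hdec := fun m (hm : 1 ≤ m) K => decay hP hq0 hq hρ (by linarith) b N (m := m) hm K
  rw [sub_sub_cancel] at hdec
  set pp := ∏ i ∈ Finset.range N, Q (b i) (b (i + 1)) with hppdef
  have hpp1 : pp ≤ 1 := hppN.trans (pow_le_one₀ (by linarith) (by linarith))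
  have hN : N * pp ≤ q⁻¹ := by
    have h := geom_part (ρ := 1 - q) (by linarith) (by linarith) (Finset.range N) 0
    simp only [Nat.zero_le, if_true, Nat.sub_zero, sub_sub_cancel] at h
    refine le_trans ?_ h
    calc (N : ℝ) * pp = ∑ j ∈ Finset.range N, pp := by simp
      _ ≤ _ := Finset.sum_le_sum fun j hj => hppN.trans
        (pow_le_pow_of_le_one (by linarith) (by linarith) (Finset.mem_range.1 hj).le)
  set K := ⌈1 / pp⌉₊ with hK
  have hK1 : 1 ≤ K * pp := by
    have := Nat.le_ceil (1 / pp)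
    rwa [div_le_iff₀ hpp] at this
  have hK2 : K * pp ≤ 2 := by
    have := Nat.ceil_lt_add_one (a := 1 / pp) (by positivity)
    have h2 : (K : ℝ) * pp ≤ (1 / pp + 1) * pp := mul_le_mul_of_nonneg_right this.le hpp.le
    rw [add_mul, div_mul_cancel₀ _ hpp.ne'] at h2
    linarith
  have hD : 0 < q⁻¹ + 2 := by positivity
  refine ⟨N + K, by push_cast; linarith, fun r => ?_⟩
  have hδ1 : q / (q⁻¹ + 2) ≤ 1 := by
    rw [div_le_one hD]
    have : 0 < q⁻¹ := by positivity
    linarith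
  induction r with
  | zero => simp
  | succ r ih =>
    have h := hdec (1 + r * (N + K)) (by omega) K
    rw [show 1 + r * (N + K) + (N + K) = 1 + (r + 1) * (N + K) by ring] at h
    set f := P.real (MNo b N (1 + r * (N + K)))
    set f' := P.real (MNo b N (1 + (r + 1) * (N + K))) with hf'
    have hf0 : 0 ≤ f := measureReal_nonneg
    have hff : f' ≤ f := by
      refine measureReal_mono fun y hy j h2 hj => hy j h2 (hj.trans ?_)
      gcongr; omega
    have h1 : f * q ≤ (f - f') * (q⁻¹ + 2) := by
      calc f * q = 1 * (f * q) := by ring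
        _ ≤ (K * pp) * (f * q) := by gcongr
        _ = K * (f * q * pp) := by ring
        _ ≤ _ := h
        _ ≤ _ := mul_le_mul_of_nonneg_left (by linarith) (by linarith)
    have h2 : f' ≤ f * (1 - q / (q⁻¹ + 2)) := by
      have : f * q / (q⁻¹ + 2) ≤ f - f' := by rwa [div_le_iff₀ hD]
      rw [mul_sub, mul_one, ← mul_div_assoc]
      linarith
    rw [pow_succ]
    exact h2.trans (mul_le_mul_of_nonneg_right ih (by linarith))

lemma cyl_eq {n : ℕ} (hn : 1 ≤ n) (x : ℕ → A) (hμstat : ∀ y, ∑ x, μ x * Q x y = μ y)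
    (hP : ∀ (n : ℕ) (a : ℕ → A), (P {ω | ∀ i ≤ n, ω i = a i}).toReal
        = μ (a 0) * ∏ i ∈ Finset.range n, Q (a i) (a (i + 1))) (t : ℕ) :
    P.real (MOcc (fun i => x (i + 1)) (n - 1) t) = cylProb P n x := by
  have : cylProb P n x = P.real (MOcc (fun i => x (i + 1)) (n - 1) 1) := by
    rw [cylProb, measureReal_def]
    congr 2
    ext y
    constructor
    · intro h i hi
      rw [add_comm]
      exact h (i + 1) (by omega) (by omega)
    · intro h i h1 hi
      have := h (i - 1) (by omega)
      simp only at this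
      rwa [Nat.sub_add_cancel h1, Nat.add_sub_cancel' h1] at this
  rw [this, occ_law hμstat hP, occ_law hμstat hP]

lemma wait_set {n : ℕ} (hn : 1 ≤ n) (x y : ℕ → A) (k : ℕ) :
    (∀ i, 1 ≤ i → i ≤ n → y (k + i) = x i) ↔ y ∈ MOcc (fun i => x (i + 1)) (n - 1) (k + 1) := by
  constructor
  · intro h i hi
    rw [show k + 1 + i = k + (i + 1) by ring]
    exact h (i + 1) (by omega) (by omega)
  · intro h i h1 hi
    have := h (i - 1) (by omega)
    simp only at this
    rwa [Nat.sub_add_cancel h1, show k + 1 + (i - 1) = k + i by omega] at this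

lemma lower_bad {n : ℕ} (hn : 1 ≤ n) (x : ℕ → A) (hμstat : ∀ y, ∑ x, μ x * Q x y = μ y)
    (hP : ∀ (n : ℕ) (a : ℕ → A), (P {ω | ∀ i ≤ n, ω i = a i}).toReal
        = μ (a 0) * ∏ i ∈ Finset.range n, Q (a i) (a (i + 1))) {ε : ℝ} (hε : 0 ≤ ε) :
    P.real {y | 0 < waitingTime n x y * cylProb P n x ∧ waitingTime n x y * cylProb P n x < ε}
      ≤ ε := by
  have hp0 : 0 ≤ cylProb P n x := ENNReal.toReal_nonneg
  rcases hp0.eq_or_lt with h0 | hp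
  · simp [← h0, hε]
  set M := ⌊ε / cylProb P n x⌋₊ with hM
  have hsub : {y | 0 < waitingTime n x y * cylProb P n x ∧
      waitingTime n x y * cylProb P n x < ε} ⊆
      ⋃ k ∈ Finset.Icc 1 M, MOcc (fun i => x (i + 1)) (n - 1) (k + 1) := by
    rintro y ⟨h1, h2⟩
    have hW : 0 < waitingTime n x y := by
      rcases Nat.eq_zero_or_pos (waitingTime n x y) with h | h
      · simp [h] at h1
      · exact h
    have hne : {k | 1 ≤ k ∧ ∀ i, 1 ≤ i → i ≤ n → y (k + i) = x i}.Nonempty :=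
      Nat.nonempty_of_pos_sInf hW
    have hmem := Nat.sInf_mem hne
    simp only [Set.mem_iUnion, Finset.mem_Icc]
    refine ⟨waitingTime n x y, ⟨hW, ?_⟩, (wait_set hn x y _).1 hmem.2⟩
    rw [hM]
    refine Nat.le_floor ?_
    rw [le_div_iff₀ hp]
    exact h2.le
  refine (measureReal_mono hsub (measure_ne_top _ _)).trans ((measureReal_biUnion_finset_le _ _).trans ?_)
  simp only [cyl_eq hn x hμstat hP]
  rw [Finset.sum_const, Nat.card_Icc, nsmul_eq_mul, Nat.add_sub_cancel]
  rw [← le_div_iff₀ hp]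
  exact Nat.floor_le (by positivity)

lemma upper_bad {n : ℕ} (hn : 3 ≤ n) (x : ℕ → A) (hμstat : ∀ y, ∑ x, μ x * Q x y = μ y)
    (hμ1 : ∀ x, μ x ≤ 1)
    (hP : ∀ (n : ℕ) (a : ℕ → A), (P {ω | ∀ i ≤ n, ω i = a i}).toReal
        = μ (a 0) * ∏ i ∈ Finset.range n, Q (a i) (a (i + 1)))
    {q : ℝ} (hq0 : 0 < q) (hq1 : q < 1) (hq : ∀ x y, q ≤ Q x y) (hρ : ∀ x y, Q x y ≤ 1 - q)
    {κ : ℝ} (hκ : (2 / (q / (q⁻¹ + 2)) + 1) * (q⁻¹ + 2) ≤ κ) :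
    P.real {y | κ * Real.log n < waitingTime n x y * cylProb P n x} ≤ 1 / (n : ℝ) ^ 2 := by
  obtain ⟨L, hL, htail⟩ := tail_bound hP hq0 hq1 hq hρ (fun i => x (i + 1)) (n - 1)
  have hpp : 0 ≤ ∏ i ∈ Finset.range (n - 1), Q (x (i + 1)) (x (i + 1 + 1)) :=
    Finset.prod_nonneg fun i _ => hq0.le.trans (hq _ _)
  have hppp : cylProb P n x ≤ ∏ i ∈ Finset.range (n - 1), Q (x (i + 1)) (x (i + 1 + 1)) := by
    rw [← cyl_eq (by omega) x hμstat hP 0, occ_law hμstat hP]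
    exact mul_le_of_le_one_left hpp (hμ1 _)
  have hp0 : 0 ≤ cylProb P n x := ENNReal.toReal_nonneg
  have hD : 0 < q⁻¹ + 2 := by positivity
  set D := q⁻¹ + 2 with hDdef
  set δ := q / D with hδ
  have hδ0 : 0 < δ := by positivity
  have hn0 : (0 : ℝ) < n := by exact_mod_cast (by omega : 0 < n)
  have hlog : 1 ≤ Real.log n := by
    rw [Real.le_log_iff_exp_le hn0]
    have : (3 : ℝ) ≤ n := by exact_mod_cast hn
    linarith [Real.exp_one_lt_d9]
  set r := ⌈2 / δ * Real.log n⌉₊ with hr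
  have hr1 : 2 / δ * Real.log n ≤ r := Nat.le_ceil _
  have hr2 : (r : ℝ) ≤ 2 / δ * Real.log n + 1 := (Nat.ceil_lt_add_one (by positivity)).le
  have hsub : {y | κ * Real.log n < waitingTime n x y * cylProb P n x} ⊆
      MNo (fun i => x (i + 1)) (n - 1) (1 + r * L) := by
    intro y hy j h2 hj hocc
    have hy' : κ * Real.log n < waitingTime n x y * cylProb P n x := hy
    have hW : waitingTime n x y ≤ j - 1 := by
      refine Nat.sInf_le ⟨by omega, (wait_set (by omega) x y _).2 ?_⟩
      rwa [Nat.sub_add_cancel (by omega)]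
    have hW2 : (waitingTime n x y : ℝ) ≤ r * L := by
      exact_mod_cast (by omega : waitingTime n x y ≤ r * L)
    have : waitingTime n x y * cylProb P n x ≤ κ * Real.log n := by
      calc (waitingTime n x y : ℝ) * cylProb P n x
          ≤ (r * L) * ∏ i ∈ Finset.range (n - 1), Q (x (i + 1)) (x (i + 1 + 1)) := by
            gcongr
        _ = r * (L * ∏ i ∈ Finset.range (n - 1), Q (x (i + 1)) (x (i + 1 + 1))) := by ring
        _ ≤ r * D := by gcongr
        _ ≤ (2 / δ * Real.log n + 1 * Real.log n) * D := by gcongr; linarith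
        _ = ((2 / δ + 1) * D) * Real.log n := by ring
        _ ≤ _ := by gcongr
    linarith
  refine (measureReal_mono hsub).trans ((htail r).trans ?_)
  have hδ1 : δ ≤ 1 := by
    rw [hδ, div_le_one hD, hDdef]
    have : 0 < q⁻¹ := by positivity
    linarith
  calc (1 - δ) ^ r ≤ (Real.exp (-δ)) ^ r := by
        refine pow_le_pow_left₀ (by linarith) ?_ _
        linarith [Real.add_one_le_exp (-δ)]
    _ = Real.exp (-(δ * r)) := by rw [← Real.exp_nat_mul]; congr 1; ring
    _ ≤ Real.exp (-(2 * Real.log n)) := by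
        refine Real.exp_le_exp.2 (neg_le_neg ?_)
        calc 2 * Real.log n = δ * (2 / δ * Real.log n) := by field_simp
          _ ≤ _ := by gcongr
    _ = 1 / (n : ℝ) ^ 2 := by
        rw [Real.exp_neg, two_mul, Real.exp_add, Real.exp_log hn0, one_div, sq]

lemma prod_bound (R : Measure (ℕ → A)) [IsProbabilityMeasure R] (n : ℕ)
    (B : (ℕ → A) → Set (ℕ → A)) (hB : ∀ x x' : ℕ → A, (∀ i ≤ n, x i = x' i) → B x = B x')
    {ε : ENNReal} (hε : ∀ x, P (B x) ≤ ε) :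
    (R.prod P) {z | z.2 ∈ B z.1} ≤ ε := by
  classical
  have hne : Nonempty (ℕ → A) := by
    by_contra h
    rw [not_nonempty_iff] at h
    have h1 : R Set.univ = 1 := measure_univ
    rw [Set.univ_eq_empty_iff.2 h] at h1
    simp at h1
  obtain ⟨x0⟩ := hne
  set F : (ℕ → A) → (Fin (n + 1) → A) := fun y i => y i with hF
  set rep : (Fin (n + 1) → A) → (ℕ → A) := fun u i => if h : i < n + 1 then u ⟨i, h⟩ else x0 0
    with hrep
  have hsub : {z : (ℕ → A) × (ℕ → A) | z.2 ∈ B z.1} ⊆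
      ⋃ u ∈ (Finset.univ : Finset (Fin (n + 1) → A)), (F ⁻¹' {u}) ×ˢ B (rep u) := by
    rintro ⟨x, y⟩ hz
    simp only [Set.mem_iUnion]
    refine ⟨F x, Finset.mem_univ _, rfl, ?_⟩
    have : B (rep (F x)) = B x := by
      refine hB _ _ fun i hi => ?_
      simp only [hrep, hF]
      rw [dif_pos (by omega)]
    rw [this]
    exact hz
  refine (measure_mono hsub).trans ((measure_biUnion_finset_le _ _).trans ?_)
  calc ∑ u, (R.prod P) ((F ⁻¹' {u}) ×ˢ B (rep u))
      ≤ ∑ u, R (F ⁻¹' {u}) * ε := by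
        refine Finset.sum_le_sum fun u _ => ?_
        rw [Measure.prod_prod]
        exact mul_le_mul_right (hε _) _
    _ = ε := by
        rw [← Finset.sum_mul, sum_measure_preimage_singleton _ (fun u _ => fiber_meas n u)]
        simp

lemma ae_core [Nonempty A] (hQpos : ∀ x y, 0 < Q x y) (hQrow : ∀ x, ∑ y, Q x y = 1)
    (hμnonneg : ∀ x, 0 ≤ μ x) (hμsum : ∑ x, μ x = 1)
    (hμstat : ∀ y, ∑ x, μ x * Q x y = μ y)
    (hP : ∀ (n : ℕ) (a : ℕ → A), (P {ω | ∀ i ≤ n, ω i = a i}).toReal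
        = μ (a 0) * ∏ i ∈ Finset.range n, Q (a i) (a (i + 1)))
    (R : Measure (ℕ → A)) [IsProbabilityMeasure R] :
    ∃ κ : ℝ, 0 < κ ∧ ∀ κ' ≥ κ, ∀ᵐ z ∂(R.prod P), ∀ᶠ n : ℕ in atTop,
        -2 * Real.log n
            ≤ Real.log ((waitingTime n z.1 z.2 : ℝ) * cylProb P n z.1) ∧
        Real.log ((waitingTime n z.1 z.2 : ℝ) * cylProb P n z.1)
            ≤ Real.log (κ' * Real.log n) := by
  classical
  have hlog : ∀ n : ℕ, 3 ≤ n → 1 ≤ Real.log n := by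
    intro n hn
    have h3 : (3 : ℝ) ≤ n := by exact_mod_cast hn
    rw [Real.le_log_iff_exp_le (by linarith)]
    linarith [Real.exp_one_lt_d9]
  have hzero : ∀ κ' : ℝ, 1 ≤ κ' → ∀ n : ℕ, 3 ≤ n →
      -2 * Real.log n ≤ 0 ∧ 0 ≤ Real.log (κ' * Real.log n) := by
    intro κ' hκ n hn
    have := hlog n hn
    exact ⟨by linarith, Real.log_nonneg (by nlinarith)⟩
  rcases subsingleton_or_nontrivial A with hA | hA
  · refine ⟨1, one_pos, fun κ' hκ => Eventually.of_forall fun z => ?_⟩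
    filter_upwards [eventually_ge_atTop 3] with n hn
    have h1 : waitingTime n z.1 z.2 = 1 := by
      have hne : {k | 1 ≤ k ∧ ∀ i, 1 ≤ i → i ≤ n → z.2 (k + i) = z.1 i}.Nonempty :=
        ⟨1, le_rfl, fun _ _ _ => Subsingleton.elim _ _⟩
      refine le_antisymm (Nat.sInf_le ⟨le_rfl, fun _ _ _ => Subsingleton.elim _ _⟩) ?_
      exact (Nat.sInf_mem hne).1
    have h2 : cylProb P n z.1 = 1 := by
      have : {ω : ℕ → A | ∀ i, 1 ≤ i → i ≤ n → ω i = z.1 i} = Set.univ := by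
        ext ω
        simp only [Set.mem_univ, iff_true]
        exact fun _ _ _ => Subsingleton.elim _ _
      rw [cylProb, this]
      simp
    rw [h1, h2]
    simpa using hzero κ' hκ n hn
  obtain ⟨⟨x1, y1⟩, -, hmin⟩ := Finset.exists_min_image (Finset.univ : Finset (A × A))
    (fun p => Q p.1 p.2) Finset.univ_nonempty
  set q := Q x1 y1 with hqdef
  have hq0 : 0 < q := hQpos _ _
  have hq : ∀ x y, q ≤ Q x y := fun x y => hmin (x, y) (Finset.mem_univ _)
  have hρ : ∀ x y, Q x y ≤ 1 - q := by
    intro x y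
    obtain ⟨y', hy'⟩ := exists_ne y
    have h1 : Q x y' + Q x y ≤ ∑ z, Q x z := by
      rw [← Finset.sum_pair hy']
      exact Finset.sum_le_sum_of_subset_of_nonneg (Finset.subset_univ _)
        fun z _ _ => (hQpos x z).le
    rw [hQrow] at h1
    linarith [hq x y']
  have hq1 : q < 1 := by
    have := hρ x1 y1
    linarith
  have hμ1 : ∀ x, μ x ≤ 1 := fun x => by
    rw [← hμsum]
    exact Finset.single_le_sum (fun z _ => hμnonneg z) (Finset.mem_univ x)
  refine ⟨max 1 ((2 / (q / (q⁻¹ + 2)) + 1) * (q⁻¹ + 2)), by positivity, fun κ' hκ => ?_⟩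
  have hκ1 : 1 ≤ κ' := (le_max_left _ _).trans hκ
  have hκ2 := (le_max_right _ _).trans hκ
  set B : ℕ → (ℕ → A) → Set (ℕ → A) := fun n x => {y | 3 ≤ n ∧
    ((0 < waitingTime n x y * cylProb P n x ∧
      waitingTime n x y * cylProb P n x < 1 / (n : ℝ) ^ 2) ∨
    κ' * Real.log n < waitingTime n x y * cylProb P n x)} with hBdef
  have hBdep : ∀ n x x', (∀ i ≤ n, x i = x' i) → B n x = B n x' := by
    intro n x x' h
    have h1 : ∀ y, waitingTime n x y = waitingTime n x' y := by
      intro y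
      rw [waitingTime, waitingTime]
      congr 1
      ext k
      refine and_congr_right fun _ => forall_congr' fun i => forall_congr' fun _ =>
        forall_congr' fun hi => ?_
      rw [h i hi]
    have h2 : cylProb P n x = cylProb P n x' := by
      rw [cylProb, cylProb]
      congr 2
      ext y
      refine forall_congr' fun i => forall_congr' fun _ =>
        forall_congr' fun hi => ?_
      rw [h i hi]
    simp only [hBdef, h1, h2]
  have hBsmall : ∀ n x, P (B n x) ≤ ENNReal.ofReal (2 * (1 / (n : ℝ) ^ 2)) := by
    intro n x
    rw [ENNReal.le_ofReal_iff_toReal_le (measure_ne_top _ _) (by positivity)]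
    change P.real (B n x) ≤ _
    by_cases hn : 3 ≤ n
    · have hsub : B n x ⊆ {y | 0 < waitingTime n x y * cylProb P n x ∧
          waitingTime n x y * cylProb P n x < 1 / (n : ℝ) ^ 2} ∪
          {y | κ' * Real.log n < waitingTime n x y * cylProb P n x} := fun y hy => hy.2
      have h1 := lower_bad (P := P) (n := n) (by omega) x hμstat hP (ε := 1 / (n : ℝ) ^ 2)
        (by positivity)
      have h2 := upper_bad hn x hμstat hμ1 hP hq0 hq1 hq hρ hκ2
      have h3 := measureReal_mono (μ := P) hsub
      have h4 := h3.trans (measureReal_union_le _ _)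
      linarith
    · have : B n x = ∅ := by
        ext y
        simp only [hBdef, Set.mem_empty_iff_false, iff_false]
        exact fun h => hn h.1
      rw [this]
      simp only [measureReal_empty]
      positivity
  have hBC := ae_eventually_notMem (μ := R.prod P) (s := fun n => {z | z.2 ∈ B n z.1}) (by
    have hs : Summable fun n : ℕ => 2 * (1 / (n : ℝ) ^ 2) :=
      (Real.summable_one_div_nat_pow.2 one_lt_two).mul_left 2
    refine ne_top_of_le_ne_top hs.tsum_ofReal_ne_top ?_
    exact ENNReal.tsum_le_tsum fun n => prod_bound R n (B n) (hBdep n) (hBsmall n))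
  filter_upwards [hBC] with z hz
  filter_upwards [hz, eventually_ge_atTop 3] with n hn hn3
  have hnot : ¬ (3 ≤ n ∧
    ((0 < waitingTime n z.1 z.2 * cylProb P n z.1 ∧
      waitingTime n z.1 z.2 * cylProb P n z.1 < 1 / (n : ℝ) ^ 2) ∨
    κ' * Real.log n < waitingTime n z.1 z.2 * cylProb P n z.1)) := hn
  have hw0 : 0 ≤ waitingTime n z.1 z.2 * cylProb P n z.1 :=
    mul_nonneg (Nat.cast_nonneg _) ENNReal.toReal_nonneg
  set w := waitingTime n z.1 z.2 * cylProb P n z.1 with hw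
  rcases hw0.eq_or_lt with h0 | hpos
  · rw [← h0, Real.log_zero]
    exact hzero κ' hκ1 n hn3
  · push Not at hnot
    obtain ⟨h1, h2⟩ := hnot hn3
    have hnpos : (0 : ℝ) < n := by exact_mod_cast (by omega : 0 < n)
    refine ⟨?_, Real.log_le_log hpos h2⟩
    have h3 := Real.log_le_log (by positivity) (h1 hpos)
    rw [one_div, Real.log_inv, Real.log_pow] at h3
    push_cast at h3
    linarith

end markov

/-- Almost-sure sandwich bounds for `log (W_n(X|Y) · P~_n(X_1,…,X_n))` and for
`log (W_n(X|X') · P_n(X_1,…,X_n))`. -/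
theorem stmt3
    {A : Type*} [Fintype A] [Nonempty A] [MeasurableSpace A] [MeasurableSingletonClass A]
    (QX QY : A → A → ℝ) (μ μt : A → ℝ)
    (hQXpos : ∀ x y, 0 < QX x y) (hQXrow : ∀ x, ∑ y, QX x y = 1)
    (hQYpos : ∀ x y, 0 < QY x y) (hQYrow : ∀ x, ∑ y, QY x y = 1)
    (hμnonneg : ∀ x, 0 ≤ μ x) (hμsum : ∑ x, μ x = 1)
    (hμstat : ∀ y, ∑ x, μ x * QX x y = μ y)
    (hμtnonneg : ∀ x, 0 ≤ μt x) (hμtsum : ∑ x, μt x = 1)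
    (hμtstat : ∀ y, ∑ x, μt x * QY x y = μt y)
    (P Pt : Measure (ℕ → A)) [IsProbabilityMeasure P] [IsProbabilityMeasure Pt]
    (hP : ∀ (n : ℕ) (a : ℕ → A),
      (P {ω | ∀ i ≤ n, ω i = a i}).toReal
        = μ (a 0) * ∏ i ∈ Finset.range n, QX (a i) (a (i + 1)))
    (hPt : ∀ (n : ℕ) (a : ℕ → A),
      (Pt {ω | ∀ i ≤ n, ω i = a i}).toReal
        = μt (a 0) * ∏ i ∈ Finset.range n, QY (a i) (a (i + 1))) :
    ∃ κ₁ κ₂ : ℝ, 0 < κ₁ ∧ 0 < κ₂ ∧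
      (∀ᵐ z ∂(P.prod Pt), ∀ᶠ n : ℕ in atTop,
        -κ₁ * Real.log n
            ≤ Real.log ((waitingTime n z.1 z.2 : ℝ) * cylProb Pt n z.1) ∧
        Real.log ((waitingTime n z.1 z.2 : ℝ) * cylProb Pt n z.1)
            ≤ Real.log (κ₂ * Real.log n)) ∧
      (∀ᵐ z ∂(P.prod P), ∀ᶠ n : ℕ in atTop,
        -κ₁ * Real.log n
            ≤ Real.log ((waitingTime n z.1 z.2 : ℝ) * cylProb P n z.1) ∧
        Real.log ((waitingTime n z.1 z.2 : ℝ) * cylProb P n z.1)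
            ≤ Real.log (κ₂ * Real.log n)) := by
  obtain ⟨k1, hk1, h1⟩ := ae_core hQYpos hQYrow hμtnonneg hμtsum hμtstat hPt P
  obtain ⟨k2, hk2, h2⟩ := ae_core hQXpos hQXrow hμnonneg hμsum hμstat hP P
  exact ⟨2, max k1 k2, two_pos, lt_max_of_lt_left hk1, h1 _ (le_max_left _ _),
    h2 _ (le_max_right _ _)⟩
end

section
/- Let A be a nonempty finite set, let Q_X and Q_Y be strictly positive stochastic matrices on A with stationary probability vectors mu and mu~ respectively, and let P, P~ be the stationary Markov measures determined by (Q_X, mu) and (Q_Y, mu~). Then for (P tensor P~ tensor P)-almost every (X, Y, X'), lim_{n->infinity} (1/n) ( log W_n(X|Y) - log W_n(X|X') ) = sum_{x,y in A} mu(x) Q_X(x,y) log( Q_X(x,y) / Q_Y(x,y) ). -/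
open MeasureTheory Filter Finset Real

namespace WT

/-- `φ` depends only on coordinates `≤ n`. -/
def Det {A β : Type*} (n : ℕ) (φ : (ℕ → A) → β) : Prop :=
  ∀ ω ω' : ℕ → A, (∀ i ≤ n, ω i = ω' i) → φ ω = φ ω'

def ext {A : Type*} (n : ℕ) (a : Fin (n + 1) → A) : ℕ → A :=
  fun i => a ⟨min i n, by omega⟩

def rho {A : Type*} (n : ℕ) (ω : ℕ → A) : Fin (n + 1) → A := fun i => ω i

lemma ext_rho {A : Type*} (n : ℕ) (ω : ℕ → A) : ∀ i ≤ n, ext n (rho n ω) i = ω i := by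
  intro i hi
  simp [ext, rho, hi]

section
variable {A : Type*} [Fintype A] [MeasurableSpace A] [MeasurableSingletonClass A]

lemma measurable_rho (n : ℕ) : Measurable (rho n : (ℕ → A) → _) := by
  unfold rho
  fun_prop

lemma Det.measurable {β : Type*} [MeasurableSpace β] {n : ℕ} {φ : (ℕ → A) → β} (h : Det n φ) :
    Measurable φ := by
  have : φ = (fun a => φ (ext n a)) ∘ rho n := by
    funext ω
    exact h _ _ fun i hi => (ext_rho n ω i hi).symm
  rw [this]
  exact (measurable_of_finite _).comp (measurable_rho n)

lemma lintegral_det (P : Measure (ℕ → A)) {n : ℕ} {φ : (ℕ → A) → ENNReal} (h : Det n φ) :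
    ∫⁻ ω, φ ω ∂P = ∑ a : Fin (n + 1) → A, φ (ext n a) * P {ω | ∀ i ≤ n, ω i = ext n a i} := by
  have h1 : ∫⁻ ω, φ ω ∂P = ∫⁻ ω, φ (ext n (rho n ω)) ∂P :=
    lintegral_congr fun ω => h _ _ fun i hi => (ext_rho n ω i hi).symm
  rw [h1, ← lintegral_map (f := fun a => φ (ext n a)) (measurable_of_finite _) (measurable_rho n),
    lintegral_fintype]
  refine Finset.sum_congr rfl fun a _ => ?_
  rw [Measure.map_apply (measurable_rho n) (measurableSet_singleton _)]
  congr 2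
  ext ω
  simp only [Set.mem_preimage, Set.mem_singleton_iff, Set.mem_ofPred_eq]
  constructor
  · rintro rfl i hi
    exact (ext_rho n ω i hi).symm
  · intro hω
    funext i
    have := hω i (by omega)
    simp only [rho, this, ext]
    congr 1
    ext
    simp
    omega

lemma markov (P : Measure (ℕ → A)) [IsProbabilityMeasure P] (Q : A → A → ℝ)
    (hM : ∀ (n : ℕ) (a : ℕ → A), (P {ω | ∀ i ≤ n + 1, ω i = a i}).toReal
      = (P {ω | ∀ i ≤ n, ω i = a i}).toReal * Q (a n) (a (n + 1)))
    {n : ℕ} {φ : (ℕ → A) → ENNReal} (h : Det n φ) (ψ : A → A → ENNReal) :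
    ∫⁻ ω, φ ω * ψ (ω n) (ω (n + 1)) ∂P
      = ∫⁻ ω, φ ω * ∑ y, ENNReal.ofReal (Q (ω n) y) * ψ (ω n) y ∂P := by
  have d1 : Det (n + 1) fun ω : ℕ → A => φ ω * ψ (ω n) (ω (n + 1)) := by
    intro ω ω' hω
    simp only [hω n (by omega), hω (n + 1) le_rfl, h ω ω' fun i hi => hω i (by omega)]
  have d2 : Det n fun ω : ℕ → A => φ ω * ∑ y, ENNReal.ofReal (Q (ω n) y) * ψ (ω n) y := by
    intro ω ω' hω
    simp only [hω n le_rfl, h ω ω' hω]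
  rw [lintegral_det P d1, lintegral_det P d2,
    ← (Fin.snocEquiv (fun _ : Fin (n + 2) => A)).sum_comp, Fintype.sum_prod_type_right]
  refine Finset.sum_congr rfl fun a _ => ?_
  rw [Finset.mul_sum, Finset.sum_mul]
  refine Finset.sum_congr rfl fun y _ => ?_
  have e1 : ∀ i ≤ n, ext (n + 1) (Fin.snocEquiv (fun _ : Fin (n + 2) => A) (y, a)) i
      = ext n a i := by
    intro i hi
    have : (⟨min i (n + 1), by omega⟩ : Fin (n + 2)) = Fin.castSucc ⟨min i n, by omega⟩ := by
      ext; simp; omega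
    simp only [ext, Fin.snocEquiv, Equiv.coe_fn_mk, this, Fin.snoc_castSucc]
  have e2 : ext (n + 1) (Fin.snocEquiv (fun _ : Fin (n + 2) => A) (y, a)) (n + 1) = y := by
    have : (⟨min (n + 1) (n + 1), by omega⟩ : Fin (n + 2)) = Fin.last _ := by
      ext; simp
    simp only [ext, Fin.snocEquiv, Equiv.coe_fn_mk, this, Fin.snoc_last]
  have hm := hM n (ext (n + 1) (Fin.snocEquiv (fun _ : Fin (n + 2) => A) (y, a)))
  set b := ext (n + 1) (Fin.snocEquiv (fun _ : Fin (n + 2) => A) (y, a))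
  rw [h b _ e1, e2, e1 n le_rfl]
  have e3 : {ω : ℕ → A | ∀ i ≤ n, ω i = b i} = {ω | ∀ i ≤ n, ω i = ext n a i} := by
    ext ω
    simp only [Set.mem_ofPred_eq]
    exact forall₂_congr fun i hi => by rw [e1 i hi]
  rw [e3, e2, e1 n le_rfl] at hm
  have hm' : P {ω | ∀ i ≤ n + 1, ω i = b i}
      = P {ω | ∀ i ≤ n, ω i = ext n a i} * ENNReal.ofReal (Q (ext n a n) y) := by
    rw [← ENNReal.ofReal_toReal (measure_ne_top P {ω | ∀ i ≤ n + 1, ω i = b i}), hm,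
      ENNReal.ofReal_mul ENNReal.toReal_nonneg, ENNReal.ofReal_toReal (measure_ne_top P _)]
  rw [hm']
  ring

end

lemma aux_exp {x : ℝ} (h : |x| ≤ 1) : Real.exp x ≤ 1 + x + x ^ 2 := by
  have := (abs_le.1 (Real.abs_exp_sub_one_sub_id_le h)).2
  linarith

section
variable {A : Type*} [Fintype A] [MeasurableSpace A] [MeasurableSingletonClass A]
  (P : Measure (ℕ → A)) [IsProbabilityMeasure P] (Q : A → A → ℝ)

/-- exponential moment bound -/
lemma exp_moment (hQpos : ∀ x y, 0 < Q x y) (hQrow : ∀ x, ∑ y, Q x y = 1)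
    (hM : ∀ (n : ℕ) (a : ℕ → A), (P {ω | ∀ i ≤ n + 1, ω i = a i}).toReal
      = (P {ω | ∀ i ≤ n, ω i = a i}).toReal * Q (a n) (a (n + 1)))
    (h : A → A → ℝ) (h0 : ∀ x, ∑ y, Q x y * h x y = 0) (B t : ℝ) (ht : 0 ≤ t)
    (hB : ∀ x y, |h x y| ≤ B) (htB : t * B ≤ 1) (n : ℕ) :
    ∫⁻ ω, ENNReal.ofReal (Real.exp (t * ∑ i ∈ range n, h (ω i) (ω (i + 1)))) ∂P
      ≤ ENNReal.ofReal (Real.exp (n * (t ^ 2 * B ^ 2))) := by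
  have key : ∀ x, ∑ y, ENNReal.ofReal (Q x y) * ENNReal.ofReal (Real.exp (t * h x y))
      ≤ ENNReal.ofReal (Real.exp (t ^ 2 * B ^ 2)) := by
    intro x
    have : ∀ y, ENNReal.ofReal (Q x y) * ENNReal.ofReal (Real.exp (t * h x y))
        = ENNReal.ofReal (Q x y * Real.exp (t * h x y)) := fun y =>
      (ENNReal.ofReal_mul (hQpos x y).le).symm
    simp_rw [this]
    rw [← ENNReal.ofReal_sum_of_nonneg fun y _ => mul_nonneg (hQpos x y).le (Real.exp_pos _).le]
    apply ENNReal.ofReal_le_ofReal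
    calc ∑ y, Q x y * Real.exp (t * h x y)
        ≤ ∑ y, (Q x y * (1 + t ^ 2 * B ^ 2) + t * (Q x y * h x y)) := by
          refine Finset.sum_le_sum fun y _ => ?_
          have h1 : |t * h x y| ≤ 1 := by
            rw [abs_mul, abs_of_nonneg ht]
            exact (mul_le_mul_of_nonneg_left (hB x y) ht).trans htB
          have h2 := aux_exp h1
          have h3 : h x y ^ 2 ≤ B ^ 2 := sq_le_sq' (abs_le.1 (hB x y)).1 (abs_le.1 (hB x y)).2
          have h4 : t ^ 2 * h x y ^ 2 ≤ t ^ 2 * B ^ 2 := mul_le_mul_of_nonneg_left h3 (sq_nonneg t)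
          have h5 : Real.exp (t * h x y) ≤ 1 + t ^ 2 * B ^ 2 + t * h x y := by nlinarith
          have := mul_le_mul_of_nonneg_left h5 (hQpos x y).le
          linarith
      _ = 1 + t ^ 2 * B ^ 2 := by
          rw [Finset.sum_add_distrib, ← Finset.sum_mul, ← Finset.mul_sum, h0, hQrow]; ring
      _ ≤ _ := by linarith [Real.add_one_le_exp (t ^ 2 * B ^ 2)]
  induction n with
  | zero => simp
  | succ n ih =>
    have d : Det n fun ω : ℕ → A =>
        ENNReal.ofReal (Real.exp (t * ∑ i ∈ range n, h (ω i) (ω (i + 1)))) := by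
      intro ω ω' hω
      simp only
      congr 3
      refine Finset.sum_congr rfl fun i hi => ?_
      have := Finset.mem_range.1 hi
      rw [hω i (by omega), hω (i + 1) (by omega)]
    have e : ∀ ω : ℕ → A, ENNReal.ofReal (Real.exp (t * ∑ i ∈ range (n + 1), h (ω i) (ω (i + 1))))
        = ENNReal.ofReal (Real.exp (t * ∑ i ∈ range n, h (ω i) (ω (i + 1)))) *
          ENNReal.ofReal (Real.exp (t * h (ω n) (ω (n + 1)))) := by
      intro ω
      rw [Finset.sum_range_succ, mul_add, Real.exp_add, ENNReal.ofReal_mul (Real.exp_pos _).le]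
    simp_rw [e]
    rw [markov P Q hM d fun u v => ENNReal.ofReal (Real.exp (t * h u v))]
    calc _ ≤ ∫⁻ ω, ENNReal.ofReal (Real.exp (t * ∑ i ∈ range n, h (ω i) (ω (i + 1)))) *
          ENNReal.ofReal (Real.exp (t ^ 2 * B ^ 2)) ∂P :=
          lintegral_mono fun ω => mul_le_mul_right (key (ω n)) _
      _ = (∫⁻ ω, ENNReal.ofReal (Real.exp (t * ∑ i ∈ range n, h (ω i) (ω (i + 1)))) ∂P) *
          ENNReal.ofReal (Real.exp (t ^ 2 * B ^ 2)) := lintegral_mul_const _ d.measurable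
      _ ≤ ENNReal.ofReal (Real.exp (n * (t ^ 2 * B ^ 2))) *
          ENNReal.ofReal (Real.exp (t ^ 2 * B ^ 2)) := mul_le_mul_left ih _
      _ = _ := by
          rw [← ENNReal.ofReal_mul (Real.exp_pos _).le, ← Real.exp_add]
          congr 2
          push_cast
          ring

lemma summable_exp (δ : ℝ) (hδ : 0 < δ) (C : ℝ) (hC : 0 ≤ C) :
    ∑' n : ℕ, ENNReal.ofReal (C * Real.exp (- (n * δ))) ≠ ⊤ := by
  have hs : Summable fun n : ℕ => C * Real.exp (- (n * δ)) := by
    have := (Real.summable_exp_nat_mul_iff (a := -δ)).2 (by linarith)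
    refine (this.mul_left C).congr fun n => ?_
    rw [mul_neg]
  rw [← ENNReal.ofReal_tsum_of_nonneg (fun n => by positivity) hs]
  exact ENNReal.ofReal_ne_top

lemma upper_dev (hQpos : ∀ x y, 0 < Q x y) (hQrow : ∀ x, ∑ y, Q x y = 1)
    (hM : ∀ (n : ℕ) (a : ℕ → A), (P {ω | ∀ i ≤ n + 1, ω i = a i}).toReal
      = (P {ω | ∀ i ≤ n, ω i = a i}).toReal * Q (a n) (a (n + 1)))
    (h : A → A → ℝ) (h0 : ∀ x, ∑ y, Q x y * h x y = 0) (ε : ℝ) (hε : 0 < ε) :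
    ∀ᵐ ω ∂P, ∀ᶠ n : ℕ in atTop, ∑ i ∈ range n, h (ω i) (ω (i + 1)) < n * ε := by
  obtain ⟨B, hB1, hB⟩ : ∃ B : ℝ, 1 ≤ B ∧ ∀ x y, |h x y| ≤ B := by
    refine ⟨1 + ∑ x, ∑ y, |h x y|, ?_, fun x y => ?_⟩
    · have : 0 ≤ ∑ x, ∑ y, |h x y| := by positivity
      linarith
    · have h1 : |h x y| ≤ ∑ y, |h x y| :=
        Finset.single_le_sum (f := fun y => |h x y|) (fun _ _ => abs_nonneg _) (Finset.mem_univ y)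
      have h2 : ∑ y, |h x y| ≤ ∑ x, ∑ y, |h x y| :=
        Finset.single_le_sum (f := fun x => ∑ y, |h x y|) (fun _ _ => by positivity)
          (Finset.mem_univ x)
      linarith
  obtain ⟨t, ht, htB, hte⟩ : ∃ t : ℝ, 0 < t ∧ t * B ≤ 1 ∧ t * B ^ 2 ≤ ε / 2 := by
    refine ⟨min (1 / B) (ε / 2 / B ^ 2), by positivity, ?_, ?_⟩
    · rw [← le_div_iff₀ (by positivity)]; exact min_le_left _ _
    · rw [← le_div_iff₀ (by positivity)]; exact min_le_right _ _
  have bc : ∀ n : ℕ, P {ω | n * ε ≤ ∑ i ∈ range n, h (ω i) (ω (i + 1))}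
      ≤ ENNReal.ofReal (1 * Real.exp (-(n * (t * ε / 2)))) := by
    intro n
    have hm := exp_moment P Q hQpos hQrow hM h h0 B t ht.le hB htB n
    have hmk := meas_ge_le_lintegral_div (μ := P) (f := fun ω =>
      ENNReal.ofReal (Real.exp (t * ∑ i ∈ range n, h (ω i) (ω (i + 1)))))
      (by
        apply Measurable.aemeasurable
        apply Det.measurable (n := n)
        intro ω ω' hω
        simp only
        congr 3
        refine Finset.sum_congr rfl fun i hi => ?_
        have := Finset.mem_range.1 hi
        rw [hω i (by omega), hω (i + 1) (by omega)])
      (ε := ENNReal.ofReal (Real.exp (t * (n * ε)))) (by simp [Real.exp_pos]) (by simp)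
    calc _ ≤ P {ω | ENNReal.ofReal (Real.exp (t * (n * ε))) ≤
            ENNReal.ofReal (Real.exp (t * ∑ i ∈ range n, h (ω i) (ω (i + 1))))} := by
          apply measure_mono
          intro ω hω
          simp only [Set.mem_ofPred_eq] at hω ⊢
          gcongr
      _ ≤ _ := hmk
      _ ≤ ENNReal.ofReal (Real.exp (n * (t ^ 2 * B ^ 2))) /
            ENNReal.ofReal (Real.exp (t * (n * ε))) := by gcongr
      _ = ENNReal.ofReal (Real.exp (n * (t ^ 2 * B ^ 2)) / Real.exp (t * (n * ε))) :=
          (ENNReal.ofReal_div_of_pos (Real.exp_pos _)).symm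
      _ ≤ _ := by
          apply ENNReal.ofReal_le_ofReal
          rw [← Real.exp_sub, one_mul]
          apply Real.exp_le_exp.2
          have : (n * t) * (t * B ^ 2) ≤ (n * t) * (ε / 2) :=
            mul_le_mul_of_nonneg_left hte (by positivity)
          nlinarith
  have := ae_eventually_notMem (μ := P)
    (s := fun n : ℕ => {ω | n * ε ≤ ∑ i ∈ range n, h (ω i) (ω (i + 1))})
    (ne_top_of_le_ne_top (summable_exp (t * ε / 2) (by positivity) 1 zero_le_one)
      (ENNReal.tsum_le_tsum bc))
  filter_upwards [this] with ω hω
  filter_upwards [hω] with n hn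
  simpa using hn

lemma lln0 (hQpos : ∀ x y, 0 < Q x y) (hQrow : ∀ x, ∑ y, Q x y = 1)
    (hM : ∀ (n : ℕ) (a : ℕ → A), (P {ω | ∀ i ≤ n + 1, ω i = a i}).toReal
      = (P {ω | ∀ i ≤ n, ω i = a i}).toReal * Q (a n) (a (n + 1)))
    (h : A → A → ℝ) (h0 : ∀ x, ∑ y, Q x y * h x y = 0) :
    ∀ᵐ ω ∂P, Tendsto (fun n : ℕ => (∑ i ∈ range n, h (ω i) (ω (i + 1))) / n) atTop (nhds 0) := by
  have h1 : ∀ᵐ ω ∂P, ∀ k : ℕ, ∀ᶠ n : ℕ in atTop,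
      ∑ i ∈ range n, h (ω i) (ω (i + 1)) < n * (1 / ((k : ℝ) + 1)) :=
    ae_all_iff.2 fun k => upper_dev P Q hQpos hQrow hM h h0 _ (by positivity)
  have h2 : ∀ᵐ ω ∂P, ∀ k : ℕ, ∀ᶠ n : ℕ in atTop,
      ∑ i ∈ range n, -h (ω i) (ω (i + 1)) < n * (1 / ((k : ℝ) + 1)) :=
    ae_all_iff.2 fun k => upper_dev P Q hQpos hQrow hM (fun x y => - h x y)
      (by intro x; simp [h0]) _ (by positivity)
  filter_upwards [h1, h2] with ω ha hb
  rw [Metric.tendsto_atTop']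
  intro ε hε
  obtain ⟨k, hk⟩ := exists_nat_one_div_lt hε
  obtain ⟨N, hN⟩ := eventually_atTop.1 ((ha k).and (hb k))
  refine ⟨N, fun n hn => ?_⟩
  obtain ⟨h3, h4⟩ := hN n hn.le
  have hn0 : (0 : ℝ) < n := by exact_mod_cast (Nat.zero_le N).trans_lt hn
  rw [Finset.sum_neg_distrib] at h4
  rw [Real.dist_eq, sub_zero, abs_div, abs_of_pos hn0, div_lt_iff₀ hn0]
  apply abs_lt.2
  constructor <;> nlinarith

end

lemma poisson {A : Type*} [Fintype A] [Nonempty A] (Q : A → A → ℝ) (μ : A → ℝ)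
    (hQpos : ∀ x y, 0 < Q x y) (hQrow : ∀ x, ∑ y, Q x y = 1)
    (hμsum : ∑ x, μ x = 1) (hμstat : ∀ y, ∑ x, μ x * Q x y = μ y)
    (F : A → ℝ) (hF : ∑ x, μ x * F x = 0) :
    ∃ G : A → ℝ, ∀ x, G x - ∑ y, Q x y * G y = F x := by
  have hmu : ∀ G : A → ℝ, ∑ x, μ x * (G x - ∑ y, Q x y * G y) = 0 := by
    intro G
    simp_rw [mul_sub, Finset.sum_sub_distrib, Finset.mul_sum]
    rw [Finset.sum_comm (f := fun x y => μ x * (Q x y * G y))]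
    simp_rw [← mul_assoc, ← Finset.sum_mul, hμstat]
    simp
  let T : (A → ℝ) →ₗ[ℝ] (A → ℝ) :=
    { toFun := fun G x => G x - ∑ y, Q x y * G y + ∑ y, μ y * G y
      map_add' := by
        intro G H
        funext x
        simp only [Pi.add_apply, mul_add, Finset.sum_add_distrib]
        ring
      map_smul' := by
        intro c G
        funext x
        simp only [Pi.smul_apply, smul_eq_mul, RingHom.id_apply, mul_add, mul_sub, Finset.mul_sum]
        congr 2
        · congr 1; funext y; ring
        · funext y; ring }
  have hT : ∀ G x, T G x = G x - ∑ y, Q x y * G y + ∑ y, μ y * G y := fun _ _ => rfl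
  have hTμ : ∀ G, ∑ x, μ x * T G x = ∑ y, μ y * G y := by
    intro G
    simp_rw [hT, mul_add _ (_ - _), Finset.sum_add_distrib, hmu, ← Finset.sum_mul, hμsum]
    ring
  have inj : Function.Injective T := by
    rw [← LinearMap.ker_eq_bot, LinearMap.ker_eq_bot']
    intro G hG
    have h1 : ∑ y, μ y * G y = 0 := by rw [← hTμ, hG]; simp
    have h2 : ∀ x, G x = ∑ y, Q x y * G y := by
      intro x
      have := congrFun hG x
      rw [hT, h1] at this
      simp at this
      linarith
    obtain ⟨x0, hx0⟩ := Finite.exists_max G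
    have h3 : ∀ y, G y = G x0 := by
      have hs : ∑ y, Q x0 y * (G x0 - G y) = 0 := by
        simp_rw [mul_sub, Finset.sum_sub_distrib, ← Finset.sum_mul, hQrow, ← h2]
        ring
      rw [Finset.sum_eq_zero_iff_of_nonneg
        (fun y _ => mul_nonneg (hQpos _ _).le (by linarith [hx0 y]))] at hs
      intro y
      have := hs y (Finset.mem_univ y)
      rcases mul_eq_zero.1 this with h | h
      · exact absurd h (hQpos _ _).ne'
      · linarith
    have h4 : G x0 = 0 := by
      simp_rw [h3, ← Finset.sum_mul, hμsum] at h1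
      simpa using h1
    funext y
    simp [h3 y, h4]
  obtain ⟨G, hG⟩ := (LinearMap.injective_iff_surjective.1 inj) F
  refine ⟨G, fun x => ?_⟩
  have h1 : ∑ y, μ y * G y = 0 := by rw [← hTμ, hG, hF]
  have := congrFun hG x
  rw [hT, h1] at this
  linarith

lemma lln {A : Type*} [Fintype A] [Nonempty A] [MeasurableSpace A] [MeasurableSingletonClass A]
    (P : Measure (ℕ → A)) [IsProbabilityMeasure P] (Q : A → A → ℝ) (μ : A → ℝ)
    (hQpos : ∀ x y, 0 < Q x y) (hQrow : ∀ x, ∑ y, Q x y = 1)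
    (hμsum : ∑ x, μ x = 1) (hμstat : ∀ y, ∑ x, μ x * Q x y = μ y)
    (hM : ∀ (n : ℕ) (a : ℕ → A), (P {ω | ∀ i ≤ n + 1, ω i = a i}).toReal
      = (P {ω | ∀ i ≤ n, ω i = a i}).toReal * Q (a n) (a (n + 1)))
    (f : A → A → ℝ) :
    ∀ᵐ ω ∂P, Tendsto (fun n : ℕ => (∑ i ∈ range n, f (ω i) (ω (i + 1))) / n) atTop
      (nhds (∑ x, ∑ y, μ x * Q x y * f x y)) := by
  set m := ∑ x, ∑ y, μ x * Q x y * f x y with hm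
  obtain ⟨G, hG⟩ := poisson Q μ hQpos hQrow hμsum hμstat (fun x => ∑ y, Q x y * f x y - m) (by
    simp_rw [mul_sub, Finset.sum_sub_distrib, ← Finset.sum_mul, hμsum, Finset.mul_sum, ← mul_assoc]
    simp [hm])
  have := lln0 P Q hQpos hQrow hM (fun x y => f x y - m + G y - G x) (by
    intro x
    have := hG x
    simp_rw [mul_sub, mul_add, mul_sub, Finset.sum_sub_distrib, Finset.sum_add_distrib,
      Finset.sum_sub_distrib, ← Finset.sum_mul, hQrow]
    linarith)
  filter_upwards [this] with ω hω
  obtain ⟨C, hC⟩ : ∃ C : ℝ, ∀ x, |G x| ≤ C := by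
    obtain ⟨x, hx⟩ := Finite.exists_max fun x => |G x|
    exact ⟨_, hx⟩
  have hb : Tendsto (fun n : ℕ => (G (ω n) - G (ω 0)) / n) atTop (nhds 0) := by
    have h0 : Tendsto (fun n : ℕ => (2 * C) / (n : ℝ)) atTop (nhds 0) :=
      tendsto_const_div_atTop_nhds_zero_nat _
    refine squeeze_zero_norm (fun n => ?_) h0
    rw [Real.norm_eq_abs, abs_div, Nat.abs_cast]
    gcongr
    have := abs_sub (G (ω n)) (G (ω 0))
    linarith [hC (ω n), hC (ω 0)]
  have := (hω.sub hb).add_const m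
  simp only [sub_zero, zero_add] at this
  refine this.congr' ?_
  filter_upwards [eventually_gt_atTop 0] with n hn
  have hn' : (n : ℝ) ≠ 0 := by positivity
  have e : ∑ i ∈ range n, (f (ω i) (ω (i + 1)) - m + G (ω (i + 1)) - G (ω i))
      = ∑ i ∈ range n, f (ω i) (ω (i + 1)) - n * m + (G (ω n) - G (ω 0)) := by
    rw [← Finset.sum_range_sub (fun i => G (ω i))]
    simp only [Finset.sum_sub_distrib, Finset.sum_add_distrib, Finset.sum_const,
      Finset.card_range, nsmul_eq_mul]
    ring
  rw [e]
  field_simp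
  ring

section
variable {A : Type*} [Fintype A] [MeasurableSpace A] [MeasurableSingletonClass A]
  (P : Measure (ℕ → A)) [IsProbabilityMeasure P] (Q : A → A → ℝ)

lemma Det.measurableSet {m : ℕ} {D : Set (ℕ → A)} (hD : Det m (fun ω => ω ∈ D)) :
    MeasurableSet D := by
  have := hD.measurable (β := Prop)
  exact measurableSet_setOfPred.2 this

lemma step (hM : ∀ (n : ℕ) (a : ℕ → A), (P {ω | ∀ i ≤ n + 1, ω i = a i}).toReal
      = (P {ω | ∀ i ≤ n, ω i = a i}).toReal * Q (a n) (a (n + 1)))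
    {m : ℕ} {D : Set (ℕ → A)} (hD : Det m (fun ω => ω ∈ D)) (y : A) :
    P (D ∩ {ω | ω (m + 1) = y}) = ∫⁻ ω in D, ENNReal.ofReal (Q (ω m) y) ∂P := by
  classical
  have hDm := hD.measurableSet
  have hφ : Det m (D.indicator (1 : (ℕ → A) → ENNReal)) := by
    intro ω ω' h
    have := hD ω ω' h
    simp only [eq_iff_iff] at this
    simp [Set.indicator, this]
  have h := markov P Q hM hφ (fun _ v => if v = y then 1 else 0)
  have h1 : ∀ ω : ℕ → A, D.indicator (1 : (ℕ → A) → ENNReal) ω * (if ω (m + 1) = y then 1 else 0)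
      = (D ∩ {ω | ω (m + 1) = y}).indicator 1 ω := by
    intro ω
    by_cases h1 : ω ∈ D <;> by_cases h2 : ω (m + 1) = y <;> simp [h1, h2]
  have h2 : ∀ ω : ℕ → A, D.indicator (1 : (ℕ → A) → ENNReal) ω *
      (∑ v, ENNReal.ofReal (Q (ω m) v) * (if v = y then 1 else 0))
      = D.indicator (fun ω => ENNReal.ofReal (Q (ω m) y)) ω := by
    intro ω
    by_cases h1 : ω ∈ D <;> simp [h1]
  simp_rw [h1, h2] at h
  rw [lintegral_indicator_one, lintegral_indicator hDm] at h
  · exact h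
  · refine hDm.inter ?_
    exact measurableSet_eq_fun (measurable_pi_apply (m + 1)) measurable_const

lemma block (hM : ∀ (n : ℕ) (a : ℕ → A), (P {ω | ∀ i ≤ n + 1, ω i = a i}).toReal
      = (P {ω | ∀ i ≤ n, ω i = a i}).toReal * Q (a n) (a (n + 1)))
    (hQpos : ∀ x y, 0 < Q x y)
    {m : ℕ} {D : Set (ℕ → A)} (hD : Det m (fun ω => ω ∈ D)) (x : ℕ → A) (j : ℕ) :
    P.real (D ∩ {ω | ∀ i, 1 ≤ i → i ≤ j + 1 → ω (m + i) = x i})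
      = P.real (D ∩ {ω | ω (m + 1) = x 1}) * ∏ i ∈ range j, Q (x (i + 1)) (x (i + 2)) := by
  induction j with
  | zero =>
    simp only [zero_add, range_zero, prod_empty, mul_one]
    congr 2
    ext ω
    simp only [Set.mem_ofPred_eq]
    constructor
    · intro h; exact h 1 le_rfl le_rfl
    · intro h i h1 h2
      obtain rfl : i = 1 := by omega
      exact h
  | succ j ih =>
    set E := D ∩ {ω : ℕ → A | ∀ i, 1 ≤ i → i ≤ j + 1 → ω (m + i) = x i} with hE
    have dE : Det (m + (j + 1)) (fun ω => ω ∈ E) := by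
      intro ω ω' h
      have h1 := hD ω ω' fun i hi => h i (by omega)
      simp only [eq_iff_iff] at h1
      simp only [hE, Set.mem_inter_iff, Set.mem_ofPred_eq, h1, eq_iff_iff]
      refine and_congr_right fun _ => forall_congr' fun i => forall₂_congr fun _ hi => ?_
      rw [h (m + i) (by omega)]
    have hs := step P Q hM dE (x (j + 2))
    have e : D ∩ {ω : ℕ → A | ∀ i, 1 ≤ i → i ≤ j + 1 + 1 → ω (m + i) = x i}
        = E ∩ {ω | ω (m + (j + 1) + 1) = x (j + 2)} := by
      ext ω
      simp only [hE, Set.mem_inter_iff, Set.mem_ofPred_eq, and_assoc]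
      refine and_congr_right fun _ => ⟨fun h => ⟨fun i h1 h2 => h i h1 (by omega),
        h (j + 2) (by omega) (by omega)⟩, fun h i h1 h2 => ?_⟩
      rcases Nat.lt_or_ge i (j + 2) with h3 | h3
      · exact h.1 i h1 (by omega)
      · obtain rfl : i = j + 2 := by omega
        exact h.2
    have e2 : ∫⁻ ω in E, ENNReal.ofReal (Q (ω (m + (j + 1))) (x (j + 2))) ∂P
        = ENNReal.ofReal (Q (x (j + 1)) (x (j + 2))) * P E := by
      rw [← setLIntegral_const]
      refine setLIntegral_congr_fun dE.measurableSet fun ω hω => ?_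
      rw [hω.2 (j + 1) (by omega) le_rfl]
    rw [e, Measure.real, hs, e2, ENNReal.toReal_mul, ENNReal.toReal_ofReal (hQpos _ _).le,
      Finset.prod_range_succ, ← mul_assoc, ← ih, mul_comm]
    rfl

lemma first (hM : ∀ (n : ℕ) (a : ℕ → A), (P {ω | ∀ i ≤ n + 1, ω i = a i}).toReal
      = (P {ω | ∀ i ≤ n, ω i = a i}).toReal * Q (a n) (a (n + 1)))
    {m : ℕ} {D : Set (ℕ → A)} (hD : Det m (fun ω => ω ∈ D)) (y : A) (c : ℝ) (hc0 : 0 ≤ c)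
    (hc : ∀ x y, c ≤ Q x y) :
    c * P.real D ≤ P.real (D ∩ {ω | ω (m + 1) = y}) := by
  have h : ENNReal.ofReal c * P D ≤ P (D ∩ {ω | ω (m + 1) = y}) := by
    rw [step P Q hM hD y, ← setLIntegral_const]
    exact lintegral_mono fun ω => ENNReal.ofReal_le_ofReal (hc _ _)
  have := ENNReal.toReal_mono (measure_ne_top P _) h
  rwa [ENNReal.toReal_mul, ENNReal.toReal_ofReal hc0] at this

/-- likelihood -/
noncomputable def lik {A : Type*} (Q : A → A → ℝ) (n : ℕ) (x : ℕ → A) : ℝ :=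
  ∏ i ∈ range n, Q (x i) (x (i + 1))

/-- match at `k` -/
def mat {A : Type*} (n : ℕ) (x : ℕ → A) (k : ℕ) : Set (ℕ → A) :=
  {ω | ∀ i, 1 ≤ i → i ≤ n → ω (k + i) = x i}

lemma mat_det {n : ℕ} {x : ℕ → A} {k m : ℕ} (h : k + n ≤ m) :
    Det m (fun ω => ω ∈ mat n x k) := by
  intro ω ω' hω
  simp only [mat, Set.mem_ofPred_eq, eq_iff_iff]
  refine forall_congr' fun i => forall₂_congr fun _ hi => ?_
  rw [hω (k + i) (by omega)]

lemma lik_pos (hQpos : ∀ x y, 0 < Q x y) (n : ℕ) (x : ℕ → A) : 0 < lik Q n x :=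
  Finset.prod_pos fun _ _ => hQpos _ _

lemma mat_bounds (hM : ∀ (n : ℕ) (a : ℕ → A), (P {ω | ∀ i ≤ n + 1, ω i = a i}).toReal
      = (P {ω | ∀ i ≤ n, ω i = a i}).toReal * Q (a n) (a (n + 1)))
    (hQpos : ∀ x y, 0 < Q x y) (c : ℝ) (hc0 : 0 < c)
    (hc : ∀ x y, c ≤ Q x y) (hQ1 : ∀ x y, Q x y ≤ 1) (x : ℕ → A) (n : ℕ) (hn : 1 ≤ n) :
    (∀ k, P.real (mat n x k) ≤ lik Q n x / c) ∧
    ∀ m (D : Set (ℕ → A)), Det m (fun ω => ω ∈ D) →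
      c * lik Q n x * P.real D ≤ P.real (D ∩ mat n x m) := by
  obtain ⟨j, rfl⟩ : ∃ j, n = j + 1 := ⟨n - 1, by omega⟩
  have hl : lik Q (j + 1) x = (∏ i ∈ range j, Q (x (i + 1)) (x (i + 2))) * Q (x 0) (x 1) := by
    simp [lik, Finset.prod_range_succ']
  have hpos : 0 < ∏ i ∈ range j, Q (x (i + 1)) (x (i + 2)) :=
    Finset.prod_pos fun _ _ => hQpos _ _
  constructor
  · intro k
    have := block P Q hM hQpos (m := k) (D := Set.univ) (fun _ _ _ => by simp) x j
    rw [Set.univ_inter] at this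
    rw [mat, this, hl, le_div_iff₀ hc0]
    have h1 : P.real (Set.univ ∩ {ω : ℕ → A | ω (k + 1) = x 1}) ≤ 1 := measureReal_le_one
    calc _ ≤ (1 * ∏ i ∈ range j, Q (x (i + 1)) (x (i + 2))) * Q (x 0) (x 1) := by
          gcongr
          exact hc _ _
      _ = _ := by ring
  · intro m D hD
    have h1 := block P Q hM hQpos hD x j
    have h2 := first P Q hM hD (x 1) c hc0.le hc
    rw [mat, h1, hl]
    calc _ = c * P.real D * (∏ i ∈ range j, Q (x (i + 1)) (x (i + 2))) * Q (x 0) (x 1) := by ring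
      _ ≤ c * P.real D * (∏ i ∈ range j, Q (x (i + 1)) (x (i + 2))) * 1 := by
          gcongr
          exact hQ1 _ _
      _ ≤ _ := by
          rw [mul_one]
          gcongr

lemma blocks (hM : ∀ (n : ℕ) (a : ℕ → A), (P {ω | ∀ i ≤ n + 1, ω i = a i}).toReal
      = (P {ω | ∀ i ≤ n, ω i = a i}).toReal * Q (a n) (a (n + 1)))
    (hQpos : ∀ x y, 0 < Q x y) (c : ℝ) (hc0 : 0 < c)
    (hc : ∀ x y, c ≤ Q x y) (hQ1 : ∀ x y, Q x y ≤ 1) (x : ℕ → A) (n : ℕ) (hn : 1 ≤ n) (K : ℕ) :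
    P.real {ω | ∀ j < K, ω ∉ mat n x (j * n + 1)} ≤ Real.exp (-(c * lik Q n x)) ^ K := by
  induction K with
  | zero => simp
  | succ K ih =>
    set D := {ω : ℕ → A | ∀ j < K, ω ∉ mat n x (j * n + 1)} with hDdef
    have hD : Det (K * n + 1) (fun ω => ω ∈ D) := by
      intro ω ω' h
      simp only [hDdef, Set.mem_ofPred_eq, eq_iff_iff]
      refine forall₂_congr fun j hj => ?_
      have h1 : j * n + 1 + n ≤ K * n + 1 := by nlinarith
      have := mat_det (x := x) h1 ω ω' h
      simp only [eq_iff_iff] at this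
      rw [this]
    have h1 := (mat_bounds P Q hM hQpos c hc0 hc hQ1 x n hn).2 _ D hD
    have e : {ω : ℕ → A | ∀ j < K + 1, ω ∉ mat n x (j * n + 1)}
        = D \ mat n x (K * n + 1) := by
      ext ω
      simp only [hDdef, Set.mem_ofPred_eq, Set.mem_sdiff]
      constructor
      · intro h
        exact ⟨fun j hj => h j (by omega), h K (by omega)⟩
      · rintro ⟨h, h'⟩ j hj
        rcases Nat.lt_or_ge j K with h3 | h3
        · exact h j h3
        · obtain rfl : j = K := by omega
          exact h'
    have hm : MeasurableSet (mat n x (K * n + 1)) := (mat_det (x := x) le_rfl).measurableSet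
    have h2 := measureReal_inter_add_sdiff (μ := P) (s := D) hm
    rw [e, pow_succ]
    have h3 : P.real (D \ mat n x (K * n + 1)) ≤ P.real D * (1 - c * lik Q n x) := by nlinarith
    calc _ ≤ _ := h3
      _ ≤ P.real D * Real.exp (-(c * lik Q n x)) := by
          gcongr
          linarith [Real.add_one_le_exp (-(c * lik Q n x))]
      _ ≤ _ := by gcongr

lemma exists_c [Nonempty A] (hQpos : ∀ x y, 0 < Q x y) : ∃ c, 0 < c ∧ ∀ x y, c ≤ Q x y := by
  obtain ⟨p, hp⟩ := Finite.exists_min fun p : A × A => Q p.1 p.2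
  exact ⟨_, hQpos p.1 p.2, fun x y => hp (x, y)⟩

lemma wait_fixed [Nonempty A]
    (hM : ∀ (n : ℕ) (a : ℕ → A), (P {ω | ∀ i ≤ n + 1, ω i = a i}).toReal
      = (P {ω | ∀ i ≤ n, ω i = a i}).toReal * Q (a n) (a (n + 1)))
    (hQpos : ∀ x y, 0 < Q x y) (hQrow : ∀ x, ∑ y, Q x y = 1) (x : ℕ → A) :
    ∀ᵐ y ∂P, Tendsto (fun n : ℕ => (Real.log (waitingTime n x y) + Real.log (lik Q n x)) / n)
      atTop (nhds 0) := by
  obtain ⟨c, hc0, hc⟩ := exists_c Q hQpos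
  have hQ1 : ∀ x y, Q x y ≤ 1 := fun x y => by
    rw [← hQrow x]
    exact Finset.single_le_sum (f := fun y => Q x y) (fun _ _ => (hQpos _ _).le)
      (Finset.mem_univ y)
  -- upper bound event
  have hU : ∀ᵐ y ∂P, ∀ᶠ n : ℕ in atTop, ∃ k, 1 ≤ k ∧ y ∈ mat n x k ∧
      (k : ℝ) ≤ n * (n / (c * lik Q n x) + 1) := by
    have hb : ∀ n : ℕ, P {y | 1 ≤ n ∧ ∀ j < ⌈(n : ℝ) / (c * lik Q n x)⌉₊,
        y ∉ mat n x (j * n + 1)} ≤ ENNReal.ofReal (1 * Real.exp (-(n * 1))) := by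
      intro n
      rcases Nat.eq_zero_or_pos n with rfl | hn
      · simp
      have h1 := blocks P Q hM hQpos c hc0 hc hQ1 x n hn ⌈(n : ℝ) / (c * lik Q n x)⌉₊
      have hl : 0 < c * lik Q n x := mul_pos hc0 (lik_pos Q hQpos n x)
      rw [← Real.exp_nat_mul] at h1
      have h2 := Nat.le_ceil ((n : ℝ) / (c * lik Q n x))
      rw [div_le_iff₀ hl] at h2
      rw [ENNReal.le_ofReal_iff_toReal_le (measure_ne_top P _) (by positivity)]
      refine le_trans (measureReal_mono ?_) (h1.trans ?_)
      · exact fun y hy => hy.2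
      · rw [one_mul]
        apply Real.exp_le_exp.2
        linarith
    have := ae_eventually_notMem (μ := P) (ne_top_of_le_ne_top (summable_exp 1 one_pos 1 zero_le_one)
      (ENNReal.tsum_le_tsum hb))
    filter_upwards [this] with y hy
    filter_upwards [hy, eventually_ge_atTop 1] with n hn hn1
    simp only [Set.mem_ofPred_eq, not_and, not_forall, not_not] at hn
    obtain ⟨j, hj, hm⟩ := hn hn1
    refine ⟨_, by omega, hm, ?_⟩
    have hl : 0 < c * lik Q n x := mul_pos hc0 (lik_pos Q hQpos n x)
    have h1 : ((⌈(n : ℝ) / (c * lik Q n x)⌉₊ : ℕ) : ℝ) < (n : ℝ) / (c * lik Q n x) + 1 :=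
      Nat.ceil_lt_add_one (by positivity)
    have h2 : (j : ℝ) + 1 ≤ (⌈(n : ℝ) / (c * lik Q n x)⌉₊ : ℕ) := by exact_mod_cast hj
    have h3 : (1 : ℝ) ≤ n := by exact_mod_cast hn1
    push_cast
    calc (j : ℝ) * n + 1 ≤ n * (j + 1) := by nlinarith
      _ ≤ _ := by gcongr; linarith
  have hL : ∀ ε : ℝ, 0 < ε → ∀ᵐ y ∂P, ∀ᶠ n : ℕ in atTop, ∀ k : ℕ, 1 ≤ k → y ∈ mat n x k →
      Real.exp (-(n * ε)) / lik Q n x < k := by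
    intro ε hε
    have hb : ∀ n : ℕ, P {y | 1 ≤ n ∧ ∃ k : ℕ, 1 ≤ k ∧ y ∈ mat n x k ∧
        (k : ℝ) ≤ Real.exp (-(n * ε)) / lik Q n x}
        ≤ ENNReal.ofReal (1 / c * Real.exp (-(n * ε))) := by
      intro n
      rcases Nat.eq_zero_or_pos n with rfl | hn
      · simp
      have hl := lik_pos Q hQpos n x
      have h1 := (mat_bounds P Q hM hQpos c hc0 hc hQ1 x n hn).1
      rw [ENNReal.le_ofReal_iff_toReal_le (measure_ne_top P _) (by positivity)]
      set N := ⌊Real.exp (-(n * ε)) / lik Q n x⌋₊ with hN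
      calc _ ≤ P.real (⋃ k ∈ Finset.Icc 1 N, mat n x k) := by
            refine measureReal_mono ?_ (measure_ne_top P _)
            rintro y ⟨-, k, hk1, hk, hk2⟩
            simp only [Set.mem_iUnion]
            exact ⟨k, Finset.mem_Icc.2 ⟨hk1, Nat.le_floor hk2⟩, hk⟩
        _ ≤ ∑ k ∈ Finset.Icc 1 N, P.real (mat n x k) := measureReal_biUnion_finset_le _ _
        _ ≤ ∑ k ∈ Finset.Icc 1 N, lik Q n x / c := Finset.sum_le_sum fun k _ => h1 k
        _ = N * (lik Q n x / c) := by simp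
        _ ≤ (Real.exp (-(n * ε)) / lik Q n x) * (lik Q n x / c) := by
            gcongr
            exact Nat.floor_le (by positivity)
        _ = _ := by field_simp
    have := ae_eventually_notMem (μ := P) (ne_top_of_le_ne_top
      (summable_exp ε hε (1 / c) (by positivity)) (ENNReal.tsum_le_tsum hb))
    filter_upwards [this] with y hy
    filter_upwards [hy, eventually_ge_atTop 1] with n hn hn1 k hk1 hk
    by_contra hcon
    exact hn ⟨hn1, k, hk1, hk, not_lt.1 hcon⟩
  have hL' : ∀ᵐ y ∂P, ∀ r : ℕ, ∀ᶠ n : ℕ in atTop, ∀ k : ℕ, 1 ≤ k → y ∈ mat n x k →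
      Real.exp (-(n * (1 / ((r : ℝ) + 1)))) / lik Q n x < k :=
    ae_all_iff.2 fun r => hL _ (by positivity)
  filter_upwards [hU, hL'] with y hyU hyL
  -- upper limit function
  have hlim : Tendsto (fun n : ℕ => (2 * Real.log n + Real.log (1 / c + 1)) / n) atTop (nhds 0) := by
    have h1 : Tendsto (fun n : ℕ => Real.log n / n) atTop (nhds 0) := by
      have := (Real.isLittleO_log_id_atTop.tendsto_div_nhds_zero).comp
        (tendsto_natCast_atTop_atTop (R := ℝ))
      exact this
    have h2 : Tendsto (fun n : ℕ => Real.log (1 / c + 1) / (n : ℝ)) atTop (nhds 0) :=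
      tendsto_const_div_atTop_nhds_zero_nat _
    have := (h1.const_mul 2).add h2
    simp only [mul_zero, zero_add] at this
    refine this.congr fun n => ?_
    ring
  rw [Metric.tendsto_atTop']
  intro ε hε
  obtain ⟨r, hr⟩ := exists_nat_one_div_lt hε
  have hev := hlim.eventually (gt_mem_nhds hε)
  obtain ⟨N, hN⟩ := eventually_atTop.1 ((hyU.and (hyL r)).and hev)
  refine ⟨N, fun n hn => ?_⟩
  obtain ⟨⟨⟨k, hk1, hkm, hkle⟩, hlow⟩, hup⟩ := hN n hn.le
  have hn0 : 1 ≤ n := by omega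
  have hn1 : (1 : ℝ) ≤ n := by exact_mod_cast hn0
  have hnpos : (0 : ℝ) < n := by linarith
  have hl := lik_pos Q hQpos n x
  have hl1 : lik Q n x ≤ 1 := Finset.prod_le_one (fun _ _ => (hQpos _ _).le) fun _ _ => hQ1 _ _
  have hmem : waitingTime n x y ∈ {k | 1 ≤ k ∧ ∀ i, 1 ≤ i → i ≤ n → y (k + i) = x i} :=
    Nat.sInf_mem ⟨k, hk1, hkm⟩
  have hWk : waitingTime n x y ≤ k := Nat.sInf_le ⟨hk1, hkm⟩
  have hWk' : (waitingTime n x y : ℝ) ≤ k := by exact_mod_cast hWk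
  have hW1 : (1 : ℝ) ≤ waitingTime n x y := by exact_mod_cast hmem.1
  have hWlow := hlow _ hmem.1 hmem.2
  set W : ℝ := (waitingTime n x y : ℝ)
  have u1 : W ≤ n ^ 2 * (1 / c + 1) / lik Q n x := by
    refine hWk'.trans (hkle.trans ?_)
    have h1 : (1 : ℝ) ≤ n / lik Q n x := by
      rw [le_div_iff₀ hl]; linarith
    calc (n : ℝ) * (n / (c * lik Q n x) + 1) ≤ n * (n / (c * lik Q n x) + n / lik Q n x) := by
          gcongr
      _ = _ := by field_simp
  have u2 : Real.log W ≤ 2 * Real.log n + Real.log (1 / c + 1) - Real.log (lik Q n x) := by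
    have := Real.log_le_log (by linarith) u1
    rwa [Real.log_div (by positivity) hl.ne', Real.log_mul (by positivity) (by positivity),
      Real.log_pow] at this
  have l2 : -(n * (1 / ((r : ℝ) + 1))) - Real.log (lik Q n x) < Real.log W := by
    have := Real.log_lt_log (by positivity) hWlow
    rwa [Real.log_div (by positivity) hl.ne', Real.log_exp] at this
  rw [div_lt_iff₀ hnpos] at hup
  rw [Real.dist_eq, sub_zero, abs_div, abs_of_pos hnpos, div_lt_iff₀ hnpos]
  apply abs_lt.2
  constructor <;> nlinarith

lemma measurable_wait (n : ℕ) :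
    Measurable fun z : (ℕ → A) × (ℕ → A) => waitingTime n z.1 z.2 := by
  have hmat : ∀ k, MeasurableSet {z : (ℕ → A) × (ℕ → A) | 1 ≤ k ∧
      ∀ i, 1 ≤ i → i ≤ n → z.2 (k + i) = z.1 i} := by
    intro k
    simp only [measurableSet_setOfPred]
    refine Measurable.and measurable_const ?_
    refine Measurable.forall fun i => Measurable.forall fun _ => Measurable.forall fun _ => ?_
    rw [← measurableSet_setOfPred]
    exact measurableSet_eq_fun (by fun_prop) (by fun_prop)
  refine measurable_to_countable' fun k => ?_
  have e : (fun z : (ℕ → A) × (ℕ → A) => waitingTime n z.1 z.2) ⁻¹' {k}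
      = {z | (z ∈ {z : (ℕ → A) × (ℕ → A) | 1 ≤ k ∧ ∀ i, 1 ≤ i → i ≤ n → z.2 (k + i) = z.1 i} ∧
          ∀ j < k, z ∉ {z : (ℕ → A) × (ℕ → A) | 1 ≤ j ∧ ∀ i, 1 ≤ i → i ≤ n → z.2 (j + i) = z.1 i})
          ∨ (k = 0 ∧ ∀ j, z ∉ {z : (ℕ → A) × (ℕ → A) | 1 ≤ j ∧
            ∀ i, 1 ≤ i → i ≤ n → z.2 (j + i) = z.1 i})} := by
    ext z
    simp only [Set.mem_preimage, Set.mem_singleton_iff]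
    rw [Set.mem_ofPred_eq]
    set S : Set ℕ := {k | 1 ≤ k ∧ ∀ i, 1 ≤ i → i ≤ n → z.2 (k + i) = z.1 i} with hS
    change sInf S = k ↔ (k ∈ S ∧ ∀ j < k, j ∉ S) ∨ (k = 0 ∧ ∀ j, j ∉ S)
    constructor
    · rintro rfl
      rcases S.eq_empty_or_nonempty with h | h
      · right; simp [h]
      · left; exact ⟨Nat.sInf_mem h, fun j hj => Nat.notMem_of_lt_sInf hj⟩
    · rintro (⟨h1, h2⟩ | ⟨rfl, h⟩)
      · refine le_antisymm (Nat.sInf_le h1) (not_lt.1 fun hlt => h2 _ hlt (Nat.sInf_mem ⟨k, h1⟩))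
      · rw [Set.eq_empty_iff_forall_notMem.2 h]; simp
  rw [e]
  simp only [measurableSet_setOfPred]
  have hk' := fun k => measurableSet_setOfPred.1 (hmat k)
  refine Measurable.or (Measurable.and (hk' k) ?_) (Measurable.and measurable_const ?_)
  · exact Measurable.forall fun j => Measurable.forall fun _ => (hk' j).not
  · exact Measurable.forall fun j => (hk' j).not

lemma measurable_lik (n : ℕ) : Measurable (lik Q n) := by
  apply Det.measurable (n := n)
  intro ω ω' hω
  refine Finset.prod_congr rfl fun i hi => ?_
  have := Finset.mem_range.1 hi
  rw [hω i (by omega), hω (i + 1) (by omega)]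

lemma wait_prod [Nonempty A] (R : Measure (ℕ → A)) [IsProbabilityMeasure R]
    (hM : ∀ (n : ℕ) (a : ℕ → A), (P {ω | ∀ i ≤ n + 1, ω i = a i}).toReal
      = (P {ω | ∀ i ≤ n, ω i = a i}).toReal * Q (a n) (a (n + 1)))
    (hQpos : ∀ x y, 0 < Q x y) (hQrow : ∀ x, ∑ y, Q x y = 1) :
    ∀ᵐ z ∂(R.prod P), Tendsto (fun n : ℕ =>
      (Real.log (waitingTime n z.1 z.2) + Real.log (lik Q n z.1)) / n) atTop (nhds 0) := by
  have hm : MeasurableSet {z : (ℕ → A) × (ℕ → A) | Tendsto (fun n : ℕ =>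
      (Real.log (waitingTime n z.1 z.2) + Real.log (lik Q n z.1)) / n) atTop (nhds 0)} := by
    refine measurableSet_tendsto (nhds 0) fun n => ?_
    have h1 : Measurable fun z : (ℕ → A) × (ℕ → A) => (waitingTime n z.1 z.2 : ℝ) :=
      measurable_from_top.comp (measurable_wait n)
    have h2 : Measurable fun z : (ℕ → A) × (ℕ → A) => lik Q n z.1 :=
      (measurable_lik Q n).comp measurable_fst
    exact (h1.log.add h2.log).div_const _
  rw [Measure.ae_prod_iff_ae_ae hm]
  exact ae_of_all _ fun x => wait_fixed P Q hM hQpos hQrow x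

end

end WT

/-- Law of large numbers: `(1/n)(log W_n(X|Y) - log W_n(X|X'))` converges a.s. to the
relative entropy per step of the chain `Q_X` with respect to the chain `Q_Y`. -/
theorem stmt6
    {A : Type*} [Fintype A] [Nonempty A] [MeasurableSpace A] [MeasurableSingletonClass A]
    (QX QY : A → A → ℝ) (μ μt : A → ℝ)
    (hQXpos : ∀ x y, 0 < QX x y) (hQXrow : ∀ x, ∑ y, QX x y = 1)
    (hQYpos : ∀ x y, 0 < QY x y) (hQYrow : ∀ x, ∑ y, QY x y = 1)
    (hμnonneg : ∀ x, 0 ≤ μ x) (hμsum : ∑ x, μ x = 1)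
    (hμstat : ∀ y, ∑ x, μ x * QX x y = μ y)
    (hμtnonneg : ∀ x, 0 ≤ μt x) (hμtsum : ∑ x, μt x = 1)
    (hμtstat : ∀ y, ∑ x, μt x * QY x y = μt y)
    (P Pt : Measure (ℕ → A)) [IsProbabilityMeasure P] [IsProbabilityMeasure Pt]
    (hP : ∀ (n : ℕ) (a : ℕ → A),
      (P {ω | ∀ i ≤ n, ω i = a i}).toReal
        = μ (a 0) * ∏ i ∈ Finset.range n, QX (a i) (a (i + 1)))
    (hPt : ∀ (n : ℕ) (a : ℕ → A),
      (Pt {ω | ∀ i ≤ n, ω i = a i}).toReal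
        = μt (a 0) * ∏ i ∈ Finset.range n, QY (a i) (a (i + 1))) :
    ∀ᵐ z ∂((P.prod Pt).prod P),
      Tendsto (fun n : ℕ =>
          (Real.log (waitingTime n z.1.1 z.1.2) - Real.log (waitingTime n z.1.1 z.2)) / n)
        atTop
        (nhds (∑ x, ∑ y, μ x * QX x y * Real.log (QX x y / QY x y))) := by
  have hMX : ∀ (n : ℕ) (a : ℕ → A), (P {ω | ∀ i ≤ n + 1, ω i = a i}).toReal
      = (P {ω | ∀ i ≤ n, ω i = a i}).toReal * QX (a n) (a (n + 1)) := by
    intro n a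
    rw [hP, hP, Finset.prod_range_succ, mul_assoc]
  have hMY : ∀ (n : ℕ) (a : ℕ → A), (Pt {ω | ∀ i ≤ n + 1, ω i = a i}).toReal
      = (Pt {ω | ∀ i ≤ n, ω i = a i}).toReal * QY (a n) (a (n + 1)) := by
    intro n a
    rw [hPt, hPt, Finset.prod_range_succ, mul_assoc]
  have h1 := WT.wait_prod Pt QY P hMY hQYpos hQYrow
  have h2 := WT.wait_prod P QX P hMX hQXpos hQXrow
  have h3 := WT.lln P QX μ hQXpos hQXrow hμsum hμstat hMX
    (fun x y => Real.log (QX x y / QY x y))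
  have q12 : Measure.QuasiMeasurePreserving
      (fun z : ((ℕ → A) × (ℕ → A)) × (ℕ → A) => z.1) ((P.prod Pt).prod P) (P.prod Pt) :=
    Measure.quasiMeasurePreserving_fst
  have q1 : Measure.QuasiMeasurePreserving
      (fun z : ((ℕ → A) × (ℕ → A)) × (ℕ → A) => z.1.1) ((P.prod Pt).prod P) P :=
    Measure.quasiMeasurePreserving_fst.comp q12
  have q13 : MeasurePreserving
      (fun z : ((ℕ → A) × (ℕ → A)) × (ℕ → A) => (z.1.1, z.2)) ((P.prod Pt).prod P) (P.prod P) :=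
    (measurePreserving_fst (μ := P) (ν := Pt)).prod (MeasurePreserving.id P)
  filter_upwards [q12.ae h1, q13.quasiMeasurePreserving.ae h2, q1.ae h3] with z ha hb hc
  have := (ha.sub hb).add hc
  simp only [sub_zero, zero_add] at this
  refine this.congr fun n => ?_
  have e : ∑ i ∈ range n, Real.log (QX (z.1.1 i) (z.1.1 (i + 1)) / QY (z.1.1 i) (z.1.1 (i + 1)))
      = Real.log (WT.lik QX n z.1.1) - Real.log (WT.lik QY n z.1.1) := by
    rw [WT.lik, WT.lik, Real.log_prod (fun i _ => (hQXpos _ _).ne'),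
      Real.log_prod (fun i _ => (hQYpos _ _).ne'), ← Finset.sum_sub_distrib]
    exact Finset.sum_congr rfl fun i _ =>
      Real.log_div (hQXpos _ _).ne' (hQYpos _ _).ne'
  rw [e]
  ring
end
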